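/- arXiv:2203.07873 — 5 statements merged into one kernel-verified Lean document; each statement's English description precedes it below -/
import Mathlib

section
/- Let K be a number field and S a finite set of prime ideals of O_K containing all prime ideals above 2. Let μ ∈ K with μ ≠ 0. If 2⁸(μ + 1)³/μ lies in the ring of S-integers O_S, then μ is an S-unit, i.e. μ ∈ O_S^*. -/
open NumberField IsDedekindDomain

/-- If `v 2 = 1` and the `j`-invariant `2⁸ (x + 1)³ / x` is `v`-integral, then `x` is a
`v`-unit. -/
theorem Valuation.eq_one_of_jInvariant_le_one {K Γ₀ : Type*} [Field K]
    [LinearOrderedCommGroupWithZero Γ₀] (v : Valuation K Γ₀) (h2 : v 2 = 1) {x : K} (hx : x ≠ 0)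
    (hj : v (2 ^ 8 * (x + 1) ^ 3 / x) ≤ 1) : v x = 1 := by
  have hpos : 0 < v x := zero_lt_iff.mpr (v.ne_zero_iff.mpr hx)
  have hle : v (x + 1) ^ 3 ≤ v x := by
    simpa [h2, div_le_one₀ hpos] using hj
  rcases lt_trichotomy (v x) 1 with h | h | h
  · rw [v.map_add_eq_of_lt_right (by simpa using h), map_one, one_pow] at hle
    exact absurd h hle.not_gt
  · exact h
  · rw [v.map_add_eq_of_lt_left (by simpa using h)] at hle
    exact absurd (lt_self_pow₀ h (by norm_num)) hle.not_gt

theorem stmt_10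
    (K : Type) [Field K] [NumberField K]
    (S : Set (HeightOneSpectrum (𝓞 K))) (hSfin : S.Finite)
    -- `S` contains all prime ideals above `2`
    (hS2 : ∀ P : HeightOneSpectrum (𝓞 K), (2 : 𝓞 K) ∈ P.asIdeal → P ∈ S)
    (μ : K) (hμ : μ ≠ 0)
    (hj : 2 ^ 8 * (μ + 1) ^ 3 / μ ∈ S.integer K) :
    μ ∈ S.integer K ∧ μ⁻¹ ∈ S.integer K := by
  have hunit : ∀ P : HeightOneSpectrum (𝓞 K), P ∉ S → P.valuation K μ = 1 := by
    intro P hP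
    have h2 : P.valuation K 2 = 1 := by
      have h : P.valuation K (algebraMap (𝓞 K) K 2) = 1 :=
        le_antisymm (P.valuation_le_one 2) <| not_lt.mp fun hlt =>
          hP (hS2 P ((P.valuation_lt_one_iff_mem 2).mp hlt))
      rwa [map_ofNat] at h
    exact (P.valuation K).eq_one_of_jInvariant_le_one h2 hμ (hj P hP)
  exact ⟨fun P hP => (hunit P hP).le, fun P hP => by rw [map_inv₀, hunit P hP, inv_one]⟩
end

section
/- Let K be a number field and S a finite set of prime ideals of O_K containing all prime ideals above 3. Let μ ∈ K with μ ≠ 0. If (μ + 27)(μ + 3)³/μ lies in the ring of S-integers O_S, then μ is an S-unit, i.e. μ ∈ O_S^*. -/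
open NumberField IsDedekindDomain

/-- If `3` is a unit for the valuation `v` and `(x + 27) (x + 3) ^ 3 / x` is `v`-integral,
then `x` is a unit for `v`. -/
theorem Valuation.map_eq_one_of_three_torsion_jInvariant_le_one
    {K Γ₀ : Type*} [Field K] [LinearOrderedCommGroupWithZero Γ₀] (v : Valuation K Γ₀)
    (h3 : v 3 = 1) {x : K} (hx : x ≠ 0)
    (hj : v ((x + 27) * (x + 3) ^ 3 / x) ≤ 1) : v x = 1 := by
  have h27 : v 27 = 1 := by
    rw [show (27 : K) = 3 ^ 3 by norm_num, map_pow, h3, one_pow]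
  have hpos : 0 < v x := zero_lt_iff.mpr (v.ne_zero_iff.mpr hx)
  rw [map_div₀, div_le_one₀ hpos, map_mul, map_pow] at hj
  rcases lt_trichotomy (v x) 1 with h | h | h
  · rw [v.map_add_eq_of_lt_right (h27.symm ▸ h), v.map_add_eq_of_lt_right (h3.symm ▸ h),
      h27, h3, one_pow, one_mul] at hj
    exact absurd h hj.not_gt
  · exact h
  · rw [v.map_add_eq_of_lt_left (h27.symm ▸ h), v.map_add_eq_of_lt_left (h3.symm ▸ h)] at hj
    exact absurd hj (lt_mul_of_one_lt_right hpos (one_lt_pow₀ h three_ne_zero)).not_ge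

theorem stmt_11
    (K : Type) [Field K] [NumberField K]
    (S : Set (HeightOneSpectrum (𝓞 K))) (hSfin : S.Finite)
    -- `S` contains all prime ideals above `3`
    (hS2 : ∀ P : HeightOneSpectrum (𝓞 K), (3 : 𝓞 K) ∈ P.asIdeal → P ∈ S)
    (μ : K) (hμ : μ ≠ 0)
    (hj : (μ + 27) * (μ + 3) ^ 3 / μ ∈ S.integer K) :
    μ ∈ S.integer K ∧ μ⁻¹ ∈ S.integer K := by
  have key : ∀ P : HeightOneSpectrum (𝓞 K), P ∉ S → P.valuation K μ = 1 := by
    intro P hP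
    have h3 : P.valuation K 3 = 1 := by
      rw [← map_ofNat (algebraMap (𝓞 K) K) 3]
      exact le_antisymm (P.valuation_le_one 3)
        (not_lt.mp fun h => hP (hS2 P ((P.valuation_lt_one_iff_mem 3).mp h)))
    exact (P.valuation K).map_eq_one_of_three_torsion_jInvariant_le_one h3 hμ (hj P hP)
  exact ⟨fun P hP => (key P hP).le, fun P hP => by rw [map_inv₀, key P hP, inv_one]⟩
end

section
/- Let K be a number field and S a finite set of prime ideals of O_K. Consider the set of solutions (α, β, γ) ∈ O_S^* × O_S^* × O_S of the equation α + β = γ². Declare two solutions (α₁, β₁, γ₁) and (α₂, β₂, γ₂) equivalent if there exists ε ∈ O_S^* with α₂ = ε²α₁, β₂ = ε²β₁ and γ₂ = εγ₁. Then the set of solutions has only finitely many equivalence classes under this relation. -/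
open NumberField IsDedekindDomain

/-- `x` is an `S`-unit of `K`. -/
def IsSUnit {K : Type} [Field K] [NumberField K]
    (S : Set (HeightOneSpectrum (𝓞 K))) (x : K) : Prop :=
  x ≠ 0 ∧ x ∈ S.integer K ∧ x⁻¹ ∈ S.integer K

/-- The set of solutions `(α, β, γ) ∈ O_S^* × O_S^* × O_S` of `α + β = γ ^ i`. -/
def SolSet {K : Type} [Field K] [NumberField K]
    (S : Set (HeightOneSpectrum (𝓞 K))) (i : ℕ) : Type :=
  {t : K × K × K // IsSUnit S t.1 ∧ IsSUnit S t.2.1 ∧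
    t.2.2 ∈ S.integer K ∧ t.1 + t.2.1 = t.2.2 ^ i}

/-- The scaling relation `(α₂, β₂, γ₂) = (εⁱα₁, εⁱβ₁, εγ₁)` for some `ε ∈ O_S^*`. -/
def SolRel {K : Type} [Field K] [NumberField K]
    {S : Set (HeightOneSpectrum (𝓞 K))} {i : ℕ}
    (x y : SolSet S i) : Prop :=
  ∃ ε : K, IsSUnit S ε ∧
    y.1.1 = ε ^ i * x.1.1 ∧ y.1.2.1 = ε ^ i * x.1.2.1 ∧ y.1.2.2 = ε * x.1.2.2

section Pade

open Polynomial

/-- The linear functional `p ↦ ∫₀¹ p` on polynomials. -/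
noncomputable def unitIntegral (K : Type*) [Field K] : K[X] →ₗ[K] K :=
  Polynomial.lsum fun n => ((n : K) + 1)⁻¹ • LinearMap.id

variable {K : Type*} [Field K]

theorem unitIntegral_monomial (n : ℕ) (a : K) :
    unitIntegral K (monomial n a) = ((n : K) + 1)⁻¹ * a := by
  simp [unitIntegral, Polynomial.lsum_apply, Polynomial.sum_monomial_index]

theorem unitIntegral_derivative [CharZero K] (p : K[X]) :
    unitIntegral K (derivative p) = p.eval 1 - p.eval 0 := by
  induction p using Polynomial.induction_on' with
  | add p q hp hq => simp only [map_add, hp, hq, eval_add]; ring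
  | monomial n a =>
    rcases n with _ | n
    · simp
    · have : (n : K) + 1 ≠ 0 := by exact_mod_cast n.succ_ne_zero
      simp [unitIntegral_monomial]
      field_simp

theorem exists_derivative_eq [CharZero K] (p : K[X]) : ∃ P : K[X], derivative P = p := by
  induction p using Polynomial.induction_on' with
  | add p q hp hq =>
    obtain ⟨P, rfl⟩ := hp
    obtain ⟨Q, rfl⟩ := hq
    exact ⟨P + Q, derivative_add⟩
  | monomial n a =>
    have : (n : K) + 1 ≠ 0 := by exact_mod_cast n.succ_ne_zero
    refine ⟨monomial (n + 1) (a / (n + 1)), ?_⟩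
    simp [this]

theorem unitIntegral_beta [CharZero K] (p q : ℕ) :
    unitIntegral K (X ^ p * (X - 1) ^ q) =
      (-1) ^ q * (p.factorial * q.factorial / (p + q + 1).factorial) := by
  induction q generalizing p with
  | zero =>
    have h := unitIntegral_monomial p (1 : K)
    have : (p : K) + 1 ≠ 0 := by exact_mod_cast p.succ_ne_zero
    have h2 : (p.factorial : K) ≠ 0 := by exact_mod_cast p.factorial_ne_zero
    rw [monomial_one_right_eq_X_pow] at h
    simp only [pow_zero, mul_one, h, add_zero, Nat.factorial_succ, Nat.factorial_zero]
    push_cast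
    field_simp
  | succ q ih =>
    have h := unitIntegral_derivative (X ^ (p + 1) * (X - 1) ^ (q + 1) : K[X])
    have hd : derivative (X ^ (p + 1) * (X - 1) ^ (q + 1) : K[X]) =
        ((p : K) + 1) • (X ^ p * (X - 1) ^ (q + 1)) +
        ((q : K) + 1) • (X ^ (p + 1) * (X - 1) ^ q) := by
      simp [derivative_mul, derivative_pow, smul_eq_C_mul]
      ring
    rw [hd, map_add, map_smul, map_smul, ih] at h
    have : (p : K) + 1 ≠ 0 := by exact_mod_cast p.succ_ne_zero
    have h2 : ((p + 1 + q + 1).factorial : K) ≠ 0 := by exact_mod_cast Nat.factorial_ne_zero _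
    rw [show p + (q + 1) + 1 = p + 1 + q + 1 by ring]
    simp at h
    apply mul_left_cancel₀ this
    rw [eq_neg_of_add_eq_zero_left h, Nat.factorial_succ p, Nat.factorial_succ q]
    push_cast
    field_simp
    ring

/-- The coefficient polynomial of a Padé relation between powers of `X`, `Y` and `Z = -X - Y`. -/
def padeSum (p q r : ℕ) (x z : K) : K :=
  (-1) ^ q * ∑ j ∈ Finset.range (r + 1),
    (((p + j).choose j * (p + q + r + 1).choose (r - j) : ℕ) : K) * (z ^ (r - j) * x ^ j)

theorem padeSum_mem {R : Subring K} (p q r : ℕ) {x z : K} (hx : x ∈ R) (hz : z ∈ R) :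
    padeSum p q r x z ∈ R :=
  R.mul_mem (R.pow_mem (R.neg_mem R.one_mem) _) <| R.sum_mem fun _ _ =>
    R.mul_mem (natCast_mem R _) (R.mul_mem (R.pow_mem hz _) (R.pow_mem hx _))

theorem abv_natCast_le (v : AbsoluteValue K ℝ) (n : ℕ) : v n ≤ n := by
  induction n with
  | zero => simp
  | succ n ih =>
    push_cast
    exact (v.add_le _ _).trans (by simpa using ih)

theorem abv_padeSum_le (v : AbsoluteValue K ℝ) {x z : K} {M : ℝ} (hx : v x ≤ M) (hz : v z ≤ M)
    (p q r : ℕ) :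
    v (padeSum p q r x z) ≤ 2 ^ (r + (p + r) + (p + q + r + 1)) * M ^ r := by
  have hM : 0 ≤ M := (v.nonneg x).trans hx
  have hterm : ∀ j ∈ Finset.range (r + 1),
      v ((((p + j).choose j * (p + q + r + 1).choose (r - j) : ℕ) : K) * (z ^ (r - j) * x ^ j)) ≤
        (2 : ℝ) ^ (p + r) * 2 ^ (p + q + r + 1) * M ^ r := by
    intro j hj
    have hj : j ≤ r := Nat.lt_succ_iff.mp (Finset.mem_range.mp hj)
    rw [map_mul, map_mul, map_pow, map_pow]
    have h1 : (((p + j).choose j * (p + q + r + 1).choose (r - j) : ℕ) : ℝ) ≤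
        2 ^ (p + r) * 2 ^ (p + q + r + 1) := by
      have := Nat.mul_le_mul ((Nat.choose_le_two_pow (p + j) j).trans
        (Nat.pow_le_pow_right two_pos (Nat.add_le_add_left hj p)))
        (Nat.choose_le_two_pow (p + q + r + 1) (r - j))
      exact_mod_cast this
    have h2 : v z ^ (r - j) * v x ^ j ≤ M ^ r := by
      calc v z ^ (r - j) * v x ^ j ≤ M ^ (r - j) * M ^ j := by
            gcongr
        _ = M ^ r := by rw [← pow_add, Nat.sub_add_cancel hj]
    exact mul_le_mul ((abv_natCast_le v _).trans h1) h2 (by positivity) (by positivity)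
  have hr : (r : ℝ) + 1 ≤ 2 ^ r := by exact_mod_cast Nat.lt_two_pow_self (n := r)
  rw [padeSum, map_mul, map_pow, map_neg_eq_map, map_one, one_pow, one_mul]
  calc _ ≤ ∑ j ∈ Finset.range (r + 1), (2 : ℝ) ^ (p + r) * 2 ^ (p + q + r + 1) * M ^ r :=
        (v.sum_le _ _).trans (Finset.sum_le_sum hterm)
    _ = (r + 1) * (2 ^ (p + r) * 2 ^ (p + q + r + 1) * M ^ r) := by simp
    _ ≤ 2 ^ r * (2 ^ (p + r) * 2 ^ (p + q + r + 1) * M ^ r) := by gcongr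
    _ = _ := by ring

/-- The normalising factor making the Padé coefficients integral. -/
noncomputable def padeScale (K : Type*) [Field K] (p q r : ℕ) : K :=
  (p + q + r + 1).factorial / (p.factorial * q.factorial * r.factorial)

theorem eval_sub_eval_eq_padeSum [CharZero K] {p q r : ℕ} {a b c : K} {H : K[X]}
    (hH : derivative H =
      C (padeScale K p q r) * ((X - C a) ^ p * (X - C b) ^ q * (X - C c) ^ r)) :
    H.eval b - H.eval a = (b - a) ^ (p + q + 1) * padeSum p q r (b - a) (a - c) := by
  have h := unitIntegral_derivative (H.comp (C a + C (b - a) * X))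
  have hcomp : derivative (H.comp (C a + C (b - a) * X)) =
      ∑ j ∈ Finset.range (r + 1), (padeScale K p q r * (b - a) ^ (p + q + 1) *
        ((a - c) ^ (r - j) * (b - a) ^ j * (r.choose j : ℕ))) •
          (X ^ (p + j) * (X - 1) ^ q) := by
    have e1 : (C a + C (b - a) * X - C a : K[X]) = C (b - a) * X := by ring
    have e2 : (C a + C (b - a) * X - C b : K[X]) = C (b - a) * (X - 1) := by
      simp only [C_sub]; ring
    have e3 : (C a + C (b - a) * X - C c : K[X]) = C (b - a) * X + C (a - c) := by
      simp only [C_sub]; ring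
    simp only [derivative_comp, hH, mul_comp, C_comp, pow_comp, sub_comp, X_comp, e1, e2, e3,
      add_pow, smul_eq_C_mul, derivative_add, derivative_C, derivative_mul, derivative_X,
      Finset.mul_sum]
    refine Finset.sum_congr rfl fun j _ => ?_
    simp only [C_mul, C_pow, map_natCast]
    generalize (X - 1 : K[X]) = u
    ring
  rw [hcomp, map_sum] at h
  simp only [eval_comp, eval_add, eval_C, eval_mul, eval_X, mul_one, mul_zero, add_zero,
    add_sub_cancel, map_smul, unitIntegral_beta, smul_eq_mul] at h
  rw [← h, padeSum, Finset.mul_sum, Finset.mul_sum]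
  refine Finset.sum_congr rfl fun j hj => ?_
  have hj : j ≤ r := Nat.lt_succ_iff.mp (Finset.mem_range.mp hj)
  have f : ∀ m : ℕ, (m.factorial : K) ≠ 0 := fun m => by exact_mod_cast m.factorial_ne_zero
  rw [padeScale, Nat.cast_mul, Nat.cast_choose K hj, Nat.cast_choose K (Nat.le_add_left j p),
    Nat.cast_choose K (show r - j ≤ p + q + r + 1 by omega), Nat.add_sub_cancel,
    show p + q + r + 1 - (r - j) = p + j + q + 1 by omega]
  have := f p; have := f q; have := f r; have := f j; have := f (r - j)
  have := f (p + j + q + 1); have := f (p + j); have := f (p + q + r + 1)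
  field_simp

theorem pow_succ_dvd_of_pow_dvd_derivative [CharZero K] {G : K[X]} {a : K} {n : ℕ}
    (ha : G.eval a = 0) (h : (X - C a) ^ n ∣ derivative G) : (X - C a) ^ (n + 1) ∣ G := by
  by_cases hG : G = 0
  · simp [hG]
  have hroot : 0 < G.rootMultiplicity a := (rootMultiplicity_pos hG).2 ha
  have hG' : derivative G ≠ 0 := by
    intro h0
    have hc := derivative_eq_zero.1 h0
    rw [eq_C_of_natDegree_eq_zero hc, eval_C] at ha
    exact hG (by rw [eq_C_of_natDegree_eq_zero hc, ha, C_0])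
  have hm := derivative_rootMultiplicity_of_root (p := G) (t := a) ha
  have := (le_rootMultiplicity_iff hG').2 h
  exact (le_rootMultiplicity_iff hG).1 (by omega)

theorem eq_zero_of_eval_eq [CharZero K] {a b c : K} (hab : a ≠ b) (hbc : b ≠ c) (hac : a ≠ c)
    {n : ℕ} {H G : K[X]} (hG : G.natDegree ≤ 1)
    (hH : derivative H = G * ((X - C a) ^ n * (X - C b) ^ n * (X - C c) ^ n))
    (h1 : H.eval a = H.eval b) (h2 : H.eval a = H.eval c) : G = 0 := by
  set P := H - C (H.eval a) with hP
  have hP' : derivative P = G * ((X - C a) ^ n * (X - C b) ^ n * (X - C c) ^ n) := by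
    simp [hP, hH]
  have da : (X - C a) ^ (n + 1) ∣ P := pow_succ_dvd_of_pow_dvd_derivative (by simp [hP])
    (hP' ▸ ⟨G * ((X - C b) ^ n * (X - C c) ^ n), by ring⟩)
  have db : (X - C b) ^ (n + 1) ∣ P := pow_succ_dvd_of_pow_dvd_derivative (by simp [hP, h1])
    (hP' ▸ ⟨G * ((X - C a) ^ n * (X - C c) ^ n), by ring⟩)
  have dc : (X - C c) ^ (n + 1) ∣ P := pow_succ_dvd_of_pow_dvd_derivative (by simp [hP, h2])
    (hP' ▸ ⟨G * ((X - C a) ^ n * (X - C b) ^ n), by ring⟩)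
  have cop : ∀ {s t : K}, s ≠ t → IsCoprime ((X - C s) ^ (n + 1)) ((X - C t) ^ (n + 1)) :=
    fun h => (isCoprime_X_sub_C_of_isUnit_sub (sub_ne_zero.2 h).isUnit).pow
  have hdvd : (X - C a) ^ (n + 1) * (X - C b) ^ (n + 1) * (X - C c) ^ (n + 1) ∣ P :=
    IsCoprime.mul_dvd (IsCoprime.mul_left (cop hac) (cop hbc))
      (IsCoprime.mul_dvd (cop hab) da db) dc
  have hmon : ∀ s : K, ∀ m, ((X - C s) ^ m).Monic := fun s m => (monic_X_sub_C s).pow m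
  have hdeg : ∀ m, ((X - C a) ^ m * (X - C b) ^ m * (X - C c) ^ m).natDegree = 3 * m := by
    intro m
    rw [Monic.natDegree_mul ((hmon a m).mul (hmon b m)) (hmon c m),
      Monic.natDegree_mul (hmon a m) (hmon b m)]
    simp only [natDegree_pow, natDegree_X_sub_C]
    ring
  have hP0 : P = 0 := by
    by_contra hne
    have hle := natDegree_le_of_dvd hdvd hne
    rw [hdeg] at hle
    have hd1 : (derivative P).natDegree ≤ 1 + 3 * n := by
      rw [hP']
      exact natDegree_mul_le.trans (by rw [hdeg]; omega)
    have hd2 := natDegree_derivative P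
    omega
  rw [hP0, derivative_zero] at hP'
  have hne : (X - C a) ^ n * (X - C b) ^ n * (X - C c) ^ n ≠ 0 :=
    (((hmon a n).mul (hmon b n)).mul (hmon c n)).ne_zero
  exact (mul_eq_zero.mp hP'.symm).resolve_right hne

/-- A Padé relation between `x ^ (2 * n + 1)`, `y ^ (2 * n + 1)` and `1` whose coefficients have
controlled size and lie in every ring containing `x` and `y`, and which is not proportional to a
given relation. -/
theorem exists_pade_relation [CharZero K] {x y a₁ a₂ : K} (hx : x ≠ 0) (hy : y ≠ 0)
    (hxy : x + y = 1) (n : ℕ) (ha : a₁ * x ^ (2 * n + 1) + a₂ * y ^ (2 * n + 1) = 1) :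
    ∃ B₁ B₂ B₃ : K, x ^ (2 * n + 1) * B₁ + y ^ (2 * n + 1) * B₂ + B₃ = 0 ∧ a₁ * B₂ ≠ a₂ * B₁ ∧
      (∀ v : AbsoluteValue K ℝ, ∀ M : ℝ, 1 ≤ M → v x ≤ M → v y ≤ M →
        v B₁ ≤ (64 * M) ^ (n + 1) ∧ v B₂ ≤ (64 * M) ^ (n + 1) ∧ v B₃ ≤ (64 * M) ^ (n + 1)) ∧
      (∀ R : Subring K, x ∈ R → y ∈ R → B₁ ∈ R ∧ B₂ ∈ R ∧ B₃ ∈ R) := by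
  set F : K[X] := (X - C 0) ^ n * (X - C x) ^ n * (X - C 1) ^ n with hF
  set s : K := padeScale K (n + 1) n n with hs
  have hs0 : s ≠ 0 := by
    have f : ∀ m : ℕ, (m.factorial : K) ≠ 0 := fun m => by exact_mod_cast m.factorial_ne_zero
    exact div_ne_zero (f _) (mul_ne_zero (mul_ne_zero (f _) (f _)) (f _))
  have hy' : 1 - x = y := by rw [← hxy]; ring
  obtain ⟨H, hH⟩ := exists_derivative_eq (C s * ((X - C 0) * F))
  obtain ⟨H', hH'⟩ := exists_derivative_eq (C s * ((X - C x) * F))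
  have sc1 : padeScale K n n (n + 1) = s := by
    simp only [hs, padeScale, show n + n + (n + 1) + 1 = n + 1 + n + n + 1 by ring]; ring
  have sc2 : padeScale K n (n + 1) n = s := by
    simp only [hs, padeScale, show n + (n + 1) + n + 1 = n + 1 + n + n + 1 by ring]; ring
  have h1 := eval_sub_eval_eq_padeSum (p := n + 1) (q := n) (r := n) (a := 0) (b := x) (c := 1)
    (H := H) (by rw [hH, hF]; ring)
  have h2 := eval_sub_eval_eq_padeSum (p := n) (q := n) (r := n + 1) (a := x) (b := 1) (c := 0)
    (H := H) (by rw [hH, hF, sc1]; ring)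
  have h3 := eval_sub_eval_eq_padeSum (p := n) (q := n + 1) (r := n) (a := 1) (b := 0) (c := x)
    (H := H) (by rw [hH, hF, sc2]; ring)
  have h1' := eval_sub_eval_eq_padeSum (p := n) (q := n + 1) (r := n) (a := 0) (b := x) (c := 1)
    (H := H') (by rw [hH', hF, sc2]; ring)
  have h2' := eval_sub_eval_eq_padeSum (p := n + 1) (q := n) (r := n) (a := x) (b := 1) (c := 0)
    (H := H') (by rw [hH', hF]; ring)
  have h3' := eval_sub_eval_eq_padeSum (p := n) (q := n) (r := n + 1) (a := 1) (b := 0) (c := x)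
    (H := H') (by rw [hH', hF, sc1]; ring)
  simp only [sub_zero, zero_sub, hy'] at h1 h2 h3 h1' h2' h3'
  have bound : ∀ p q r : ℕ, p ≤ n + 1 → r ≤ n + 1 → p + q + r = 3 * n + 1 →
      ∀ v : AbsoluteValue K ℝ, ∀ M : ℝ, 1 ≤ M → ∀ u w : K, v u ≤ M → v w ≤ M →
        v (padeSum p q r u w) ≤ 64 ^ (n + 1) * M ^ r := by
    intro p q r hp hr hpqr v M hM u w hu hw
    refine (abv_padeSum_le v hu hw p q r).trans ?_
    have : (2 : ℝ) ^ (r + (p + r) + (p + q + r + 1)) ≤ 64 ^ (n + 1) := by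
      rw [show (64 : ℝ) = 2 ^ 6 by norm_num, ← pow_mul]
      exact pow_le_pow_right₀ one_le_two (by omega)
    gcongr
  have neg1 : ∀ {v : AbsoluteValue K ℝ} {M : ℝ}, 1 ≤ M → v (-1) ≤ M := fun hM => by simpa using hM
  have low : ∀ {M : ℝ}, 1 ≤ M → (64 : ℝ) ^ (n + 1) * M ^ n ≤ (64 * M) ^ (n + 1) := fun hM => by
    rw [mul_pow]
    gcongr
    exact n.le_succ
  have up : ∀ {M : ℝ} {v : AbsoluteValue K ℝ} {u w : K}, 1 ≤ M → v u ≤ M →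
      v w ≤ 64 ^ (n + 1) * M ^ n → v (u * w) ≤ (64 * M) ^ (n + 1) := fun {M v u w} hM hu hw => by
    rw [map_mul]
    calc v u * v w ≤ M * (64 ^ (n + 1) * M ^ n) := by gcongr
      _ = _ := by ring
  have memneg1 : ∀ R : Subring K, (-1 : K) ∈ R := fun R => R.neg_mem R.one_mem
  by_contra! hcon
  have rel1 : a₁ * padeSum n n (n + 1) y x = a₂ * (x * padeSum (n + 1) n n x (-1)) := by
    by_contra hne
    obtain ⟨R, hRx, hRy, hR⟩ := hcon (x * padeSum (n + 1) n n x (-1)) (padeSum n n (n + 1) y x)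
      (padeSum n (n + 1) n (-1) y)
      (by
        have e : (-1 : K) ^ (n + (n + 1) + 1) = 1 := Even.neg_one_pow ⟨n + 1, by ring⟩
        rw [e] at h3
        linear_combination (-1) * h1 - h2 - h3) hne
      (fun v M hM hvx hvy => ⟨up hM hvx (bound _ _ _ (by omega) (by omega) (by omega) v M hM _ _
          hvx (neg1 hM)),
        (bound _ _ _ (by omega) (by omega) (by omega) v M hM _ _
          hvy hvx).trans_eq (mul_pow ..).symm,
        (bound _ _ _ (by omega) (by omega) (by omega) v M hM _ _ (neg1 hM) hvy).trans (low hM)⟩)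
    exact hR (R.mul_mem hRx (padeSum_mem _ _ _ hRx (memneg1 R))) (padeSum_mem _ _ _ hRy hRx)
      (padeSum_mem _ _ _ (memneg1 R) hRy)
  have rel2 : a₁ * (y * padeSum (n + 1) n n y x) = a₂ * (x * padeSum n (n + 1) n x (-1)) := by
    by_contra hne
    obtain ⟨R, hRx, hRy, hR⟩ := hcon (x * padeSum n (n + 1) n x (-1)) (y * padeSum (n + 1) n n y x)
      (-padeSum n n (n + 1) (-1) y)
      (by
        have e : (-1 : K) ^ (n + n + 1) = -1 := Odd.neg_one_pow ⟨n, by ring⟩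
        rw [e] at h3'
        linear_combination (-1) * h1' - h2' - h3') hne
      (fun v M hM hvx hvy => ⟨up hM hvx (bound _ _ _ (by omega) (by omega) (by omega) v M hM _ _
          hvx (neg1 hM)),
        up hM hvy (bound _ _ _ (by omega) (by omega) (by omega) v M hM _ _ hvy hvx), by
        rw [v.map_neg]
        exact (bound _ _ _ (by omega) (by omega) (by omega) v M hM _ _
          (neg1 hM) hvy).trans_eq (mul_pow ..).symm⟩)
    exact hR (R.mul_mem hRx (padeSum_mem _ _ _ hRx (memneg1 R)))
      (R.mul_mem hRy (padeSum_mem _ _ _ hRy hRx))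
      (R.neg_mem (padeSum_mem _ _ _ (memneg1 R) hRy))
  have key : ∀ l m : K, l * (H.eval x - H.eval 0) + m * (H'.eval x - H'.eval 0) = 0 →
      l * (H.eval 1 - H.eval x) + m * (H'.eval 1 - H'.eval x) = 0 → l = 0 ∧ m = 0 := by
    intro l m e1 e2
    have hG := eq_zero_of_eval_eq (a := 0) (b := x) (c := 1) hx.symm
      (by rintro rfl; exact hy (by simpa using hy'.symm)) zero_ne_one (n := n)
      (H := C l * H + C m * H') (G := C s * (C l * (X - C 0) + C m * (X - C x)))
      (by compute_degree) (by
        simp only [derivative_add, derivative_C_mul, hH, hH', hF]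
        ring)
      (by simp only [eval_add, eval_C_mul]; linear_combination -e1)
      (by simp only [eval_add, eval_C_mul]; linear_combination -e1 - e2)
    have hG := (mul_eq_zero.mp hG).resolve_left (C_ne_zero.2 hs0)
    have g0 := congrArg (eval 0) hG
    have gx := congrArg (eval x) hG
    simp at g0 gx
    exact ⟨gx.resolve_right hx, g0.resolve_right hx⟩
  have p1 : a₁ * x ^ (2 * n + 1) * (H.eval 1 - H.eval x) =
      a₂ * y ^ (2 * n + 1) * (H.eval x - H.eval 0) := by
    rw [h1, h2]
    linear_combination (x ^ (2 * n + 1) * y ^ (2 * n + 1)) * rel1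
  have p2 : a₁ * x ^ (2 * n + 1) * (H'.eval 1 - H'.eval x) =
      a₂ * y ^ (2 * n + 1) * (H'.eval x - H'.eval 0) := by
    rw [h1', h2']
    linear_combination (x ^ (2 * n + 1) * y ^ (2 * n + 1)) * rel2
  generalize a₁ * x ^ (2 * n + 1) = b₁ at ha p1 p2
  generalize a₂ * y ^ (2 * n + 1) = b₂ at ha p1 p2
  obtain rfl : b₁ = 1 - b₂ := by rw [← ha]; ring
  generalize eval x H - eval 0 H = J at *
  generalize eval 1 H - eval x H = J₂ at *
  generalize eval x H' - eval 0 H' = J' at *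
  generalize eval 1 H' - eval x H' = J₂' at *
  obtain ⟨q1, q2⟩ := key (J' + J₂') (-(J + J₂))
    (by linear_combination p2 * (J + J₂) - p1 * (J' + J₂'))
    (by linear_combination p1 * (J' + J₂') - p2 * (J + J₂))
  have z1 : J = 0 := by linear_combination -p1 - (1 - b₂) * q2
  have z2 : J₂ = 0 := by linear_combination -q2 - z1
  exact one_ne_zero (key 1 0 (by rw [z1]; ring) (by rw [z2]; ring)).1

end Pade

section UnitEquation

/-- A gap principle: a family of vectors with finitely many members in each ball is finite if no
large member is close to a large odd multiple of another member. -/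
theorem finite_of_norm_sub_smul_ge {ι E : Type*} [NormedAddCommGroup E] [NormedSpace ℝ E]
    [FiniteDimensional ℝ E] (T : Set ι) (l : ι → E) {C : ℝ} (hC : 0 ≤ C)
    (hfin : ∀ B : ℝ, {t ∈ T | ‖l t‖ ≤ B}.Finite)
    (hgap : ∀ t ∈ T, ∀ t' ∈ T, ∀ n : ℕ,
      n * ‖l t‖ / 4 ≤ C * (n + 1) + ‖l t' - (2 * n + 1 : ℝ) • l t‖) : T.Finite := by
  have : ProperSpace E := FiniteDimensional.proper_real E
  obtain ⟨s, hs, hcover⟩ := Metric.totallyBounded_iff.1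
    (isCompact_sphere (0 : E) 1).totallyBounded (1 / 64) (by norm_num)
  set e : ι → E := fun t => ‖l t‖⁻¹ • l t with he
  have hsub : T ⊆ {t ∈ T | ‖l t‖ ≤ 32 * C} ∪
      ⋃ y ∈ s, {t ∈ T | 32 * C < ‖l t‖ ∧ e t ∈ Metric.ball y (1 / 64)} := by
    intro t ht
    rcases le_or_gt ‖l t‖ (32 * C) with h | h
    · exact Or.inl ⟨ht, h⟩
    · right
      have hpos : 0 < ‖l t‖ := lt_of_le_of_lt (by positivity) h
      have : e t ∈ Metric.sphere (0 : E) 1 := by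
        simp [he, norm_smul, hpos.ne']
      obtain ⟨y, hy, hty⟩ := Set.mem_iUnion₂.1 (hcover this)
      exact Set.mem_iUnion₂.2 ⟨y, hy, ht, h, hty⟩
  refine ((hfin _).union (hs.biUnion fun y _ => ?_)).subset hsub
  rcases Set.eq_empty_or_nonempty {t ∈ T | 32 * C < ‖l t‖ ∧ e t ∈ Metric.ball y (1 / 64)} with
    h | ⟨x, hx, hxC, hxy⟩
  · rw [h]; exact Set.finite_empty
  refine (hfin (40 * ‖l x‖)).subset fun x' ⟨hx', hxC', hxy'⟩ => ⟨hx', ?_⟩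
  by_contra! hlarge
  set N := ‖l x‖ with hN
  set N' := ‖l x'‖ with hN'
  have hNpos : 0 < N := lt_of_le_of_lt (by positivity) hxC
  have hNpos' : 0 < N' := by linarith
  set n := ⌊N' / (2 * N)⌋₊ with hn
  have hn1 : (n : ℝ) * (2 * N) ≤ N' :=
    (le_div_iff₀ (by positivity)).1 (Nat.floor_le (by positivity))
  have hn2 : N' < (n + 1) * (2 * N) :=
    (div_lt_iff₀ (by positivity)).1 (Nat.lt_floor_add_one _)
  have hn20 : (19 : ℝ) ≤ n := by
    by_contra! hlt
    nlinarith
  have hex : l x = N • e x := by simp [he, ← hN, smul_smul, hNpos.ne']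
  have hex' : l x' = N' • e x' := by simp [he, ← hN', smul_smul, hNpos'.ne']
  have hnorm : ‖e x‖ = 1 := by simp [he, norm_smul, ← hN, abs_of_pos hNpos, hNpos.ne']
  have hdist : ‖e x' - e x‖ ≤ 1 / 32 := by
    rw [← dist_eq_norm]
    have := dist_triangle_right (e x') (e x) y
    rw [Metric.mem_ball] at hxy hxy'
    linarith
  have hsplit : l x' - (2 * n + 1 : ℝ) • l x =
      N' • (e x' - e x) + (N' - (2 * n + 1) * N) • e x := by
    rw [hex, hex']
    module
  have hle : ‖l x' - (2 * n + 1 : ℝ) • l x‖ ≤ N' * (1 / 32) + N := by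
    rw [hsplit]
    refine (norm_add_le _ _).trans (add_le_add ?_ ?_)
    · rw [norm_smul, Real.norm_of_nonneg hNpos'.le]
      gcongr
    · rw [norm_smul, hnorm, mul_one, Real.norm_eq_abs, abs_le]
      constructor <;> linarith
  have := hgap x hx x' hx' n
  nlinarith

variable {K P : Type*} [Field K] [Fintype P]

/-- The weighted logarithmic size of `x` at a finite family of absolute values. -/
noncomputable def logSize (abv : P → AbsoluteValue K ℝ) (w : P → ℝ) (x : K) : ℝ :=
  ∑ p, w p * |Real.log (abv p x)|

/-- An upper bound, at one absolute value, for the determinant `a₁ * B₂ - a₂ * B₁` of two linear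
relations between `x ^ (2 * n + 1)` and `y ^ (2 * n + 1)`. -/
theorem log_abv_cross_le [CharZero K] (v : AbsoluteValue K ℝ) {x y a₁ a₂ B₁ B₂ B₃ : K} {n : ℕ}
    (ha : a₁ * x ^ (2 * n + 1) + a₂ * y ^ (2 * n + 1) = 1)
    (hB : x ^ (2 * n + 1) * B₁ + y ^ (2 * n + 1) * B₂ + B₃ = 0) (hne : a₁ * B₂ - a₂ * B₁ ≠ 0)
    (hbd : ∀ M : ℝ, 1 ≤ M → v x ≤ M → v y ≤ M →
      v B₁ ≤ (64 * M) ^ (n + 1) ∧ v B₂ ≤ (64 * M) ^ (n + 1) ∧ v B₃ ≤ (64 * M) ^ (n + 1)) :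
    n * Real.log (max 1 (max (v x) (v y))) + Real.log (v (a₁ * B₂ - a₂ * B₁)) ≤
      Real.log 128 * (n + 1) + |Real.log (v a₁)| + |Real.log (v a₂)| := by
  set M := max 1 (max (v x) (v y)) with hM
  set D := a₁ * B₂ - a₂ * B₁ with hD
  set A := max 1 (max (v a₁) (v a₂)) with hA
  have hM1 : 1 ≤ M := le_max_left _ _
  have hA1 : 1 ≤ A := le_max_left _ _
  obtain ⟨h1, h2, h3⟩ := hbd M hM1 ((le_max_left _ _).trans (le_max_right _ _))
    ((le_max_right _ _).trans (le_max_right _ _))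
  have hv1 : v a₁ ≤ A := (le_max_left _ _).trans (le_max_right _ _)
  have hv2 : v a₂ ≤ A := (le_max_right _ _).trans (le_max_right _ _)
  set Q := (64 * M) ^ (n + 1) with hQ
  have hQ0 : 0 < Q := by positivity
  have two : ∀ b c d e : K, v b ≤ A → v c ≤ A → v d ≤ Q → v e ≤ Q →
      v (b * d + c * e) ≤ 2 * (A * Q) := by
    intro b c d e hb hc hd he
    refine (v.add_le _ _).trans ?_
    rw [map_mul, map_mul]
    have := mul_le_mul hb hd (v.nonneg _) (by positivity)
    have := mul_le_mul hc he (v.nonneg _) (by positivity)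
    linarith
  have hDx : v (x ^ (2 * n + 1) * D) ≤ 2 * (A * Q) := by
    rw [show x ^ (2 * n + 1) * D = 1 * B₂ + a₂ * B₃ by
      linear_combination B₂ * ha - a₂ * hB]
    exact two _ _ _ _ (by simpa using hA1) hv2 h2 h3
  have hDy : v (y ^ (2 * n + 1) * D) ≤ 2 * (A * Q) := by
    rw [show y ^ (2 * n + 1) * D = (-1) * B₁ + (-a₁) * B₃ by
      linear_combination a₁ * hB - B₁ * ha]
    exact two _ _ _ _ (by simpa using hA1) (by simpa using hv1) h1 h3
  have hD1 : v D ≤ 2 * (A * Q) := by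
    rw [show D = a₁ * B₂ + (-a₂) * B₁ by rw [hD]; ring]
    exact two _ _ _ _ hv1 (by simpa using hv2) h2 h1
  have hDpos : 0 < v D := v.pos hne
  have hall : M ^ (2 * n + 1) * v D ≤ 2 * (A * Q) := by
    rw [map_mul, map_pow] at hDx hDy
    rcases max_choice 1 (max (v x) (v y)) with h | h
    · rw [hM, h]; simpa using hD1
    · rcases max_choice (v x) (v y) with h' | h' <;> rw [hM, h, h'] <;> assumption
  have hlog := Real.log_le_log (by positivity) hall
  have hlogA : Real.log A ≤ |Real.log (v a₁)| + |Real.log (v a₂)| := by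
    rcases max_choice 1 (max (v a₁) (v a₂)) with h | h
    · rw [hA, h, Real.log_one]; positivity
    · rcases max_choice (v a₁) (v a₂) with h' | h' <;> rw [hA, h, h']
      · exact (le_abs_self _).trans (le_add_of_nonneg_right (abs_nonneg _))
      · exact (le_abs_self _).trans (le_add_of_nonneg_left (abs_nonneg _))
  rw [Real.log_mul (by positivity) hDpos.ne', Real.log_pow, Real.log_mul two_ne_zero
    (by positivity), Real.log_mul (by positivity) hQ0.ne', hQ, Real.log_pow,
    Real.log_mul (by norm_num) (by positivity)] at hlog
  have h128 : Real.log 128 = Real.log 2 + Real.log 64 := by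
    rw [← Real.log_mul (by norm_num) (by norm_num)]; norm_num
  have hl2 : 0 ≤ Real.log 2 := Real.log_nonneg one_le_two
  rw [h128]
  push_cast at hlog
  have : 0 ≤ (n : ℝ) * Real.log 2 := by positivity
  linarith

/-- Finiteness of the solutions of the unit equation `x + y = 1` over a ring whose units satisfy
a product formula and a Northcott property for a finite family of absolute values. -/
theorem finite_unit_equation [CharZero K] (abv : P → AbsoluteValue K ℝ) (w : P → ℝ)
    (hw : ∀ p, 0 ≤ w p) (R : Subring K)
    (hprod : ∀ x ∈ R, x ≠ 0 → 0 ≤ ∑ p, w p * Real.log (abv p x))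
    (hnorth : ∀ B : ℝ, {x : K | x ∈ R ∧ logSize abv w x ≤ B}.Finite) :
    {x : K | x ≠ 0 ∧ 1 - x ≠ 0 ∧ x ∈ R ∧ x⁻¹ ∈ R ∧ (1 - x)⁻¹ ∈ R}.Finite := by
  set T := {x : K | x ≠ 0 ∧ 1 - x ≠ 0 ∧ x ∈ R ∧ x⁻¹ ∈ R ∧ (1 - x)⁻¹ ∈ R}
  let l : K → PiLp 1 (fun _ : P ⊕ P => ℝ) := fun x => WithLp.toLp 1 <|
    Sum.elim (fun p => w p * Real.log (abv p x)) (fun p => w p * Real.log (abv p (1 - x)))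
  have hlnorm : ∀ x, ‖l x‖ = logSize abv w x + logSize abv w (1 - x) := by
    intro x
    simp [l, PiLp.norm_eq_of_L1, logSize, abs_mul, abs_of_nonneg (hw _)]
  have hsize0 : ∀ x, 0 ≤ logSize abv w x := fun x =>
    Finset.sum_nonneg fun p _ => mul_nonneg (hw p) (abs_nonneg _)
  set C : ℝ := (∑ p, w p) * Real.log 128 with hC
  have hC0 : 0 ≤ C := mul_nonneg (Finset.sum_nonneg fun p _ => hw p)
    (Real.log_nonneg (by norm_num))
  have hsum0 : ∀ x, x ≠ 0 → x ∈ R → x⁻¹ ∈ R → ∑ p, w p * Real.log (abv p x) = 0 := by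
    intro x hx h1 h2
    refine le_antisymm ?_ (hprod x h1 hx)
    have := hprod x⁻¹ h2 (inv_ne_zero hx)
    simpa [Finset.sum_neg_distrib] using this
  have half : ∀ x, x ≠ 0 → x ∈ R → x⁻¹ ∈ R → ∀ m : P → ℝ, (∀ p, 0 ≤ m p) →
      (∀ p, Real.log (abv p x) ≤ m p) → logSize abv w x ≤ 2 * ∑ p, w p * m p := by
    intro x hx h1 h2 m hm hle
    have : logSize abv w x ≤ ∑ p, w p * (2 * m p - Real.log (abv p x)) := by
      refine Finset.sum_le_sum fun p _ => mul_le_mul_of_nonneg_left ?_ (hw p)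
      rw [abs_le]
      constructor <;> linarith [hm p, hle p]
    refine this.trans_eq ?_
    simp only [mul_sub, Finset.sum_sub_distrib, hsum0 x hx h1 h2, sub_zero, Finset.mul_sum]
    exact Finset.sum_congr rfl fun p _ => by ring
  refine finite_of_norm_sub_smul_ge T l hC0 (fun B => (hnorth B).subset ?_) ?_
  · rintro x ⟨hx, hB⟩
    refine ⟨hx.2.2.1, ?_⟩
    rw [hlnorm] at hB
    linarith [hsize0 (1 - x)]
  · rintro x ⟨hx, hy, hxR, hxR', hyR'⟩ x' ⟨hx', hy', hxR'', -, -⟩ n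
    have hyR : 1 - x ∈ R := R.sub_mem R.one_mem hxR
    have hyR'' : 1 - x' ∈ R := R.sub_mem R.one_mem hxR''
    set y := 1 - x with hyd
    set y' := 1 - x' with hyd'
    set a₁ := x' * (x⁻¹) ^ (2 * n + 1) with ha₁
    set a₂ := y' * (y⁻¹) ^ (2 * n + 1) with ha₂
    have ha : a₁ * x ^ (2 * n + 1) + a₂ * y ^ (2 * n + 1) = 1 := by
      have e1 : a₁ * x ^ (2 * n + 1) = x' := by
        rw [ha₁, mul_assoc, ← mul_pow, inv_mul_cancel₀ hx, one_pow, mul_one]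
      have e2 : a₂ * y ^ (2 * n + 1) = y' := by
        rw [ha₂, mul_assoc, ← mul_pow, inv_mul_cancel₀ hy, one_pow, mul_one]
      rw [e1, e2, hyd']; ring
    obtain ⟨B₁, B₂, B₃, hB, hne, hbd, hmem⟩ :=
      exists_pade_relation hx hy (by rw [hyd]; ring) n ha
    obtain ⟨m1, m2, -⟩ := hmem R hxR hyR
    have hD0 : a₁ * B₂ - a₂ * B₁ ≠ 0 := sub_ne_zero.2 hne
    have hDR : a₁ * B₂ - a₂ * B₁ ∈ R := R.sub_mem
      (R.mul_mem (R.mul_mem hxR'' (R.pow_mem hxR' _)) m2)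
      (R.mul_mem (R.mul_mem hyR'' (R.pow_mem hyR' _)) m1)
    have hloc := fun p => mul_le_mul_of_nonneg_left
      (log_abv_cross_le (abv p) ha hB hD0 (hbd (abv p))) (hw p)
    have hsum := Finset.sum_le_sum fun p (_ : p ∈ Finset.univ) => hloc p
    set m : P → ℝ := fun p => Real.log (max 1 (max (abv p x) (abv p y))) with hm
    have hm0 : ∀ p, 0 ≤ m p := fun p => Real.log_nonneg (le_max_left _ _)
    have hx2 := half x hx hxR hxR' m hm0 fun p => Real.log_le_log ((abv p).pos hx)
      ((le_max_left _ _).trans (le_max_right _ _))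
    have hy2 := half y hy hyR hyR' m hm0 fun p => Real.log_le_log ((abv p).pos hy)
      ((le_max_right _ _).trans (le_max_right _ _))
    have hdiff : ‖l x' - (2 * n + 1 : ℝ) • l x‖ = logSize abv w a₁ + logSize abv w a₂ := by
      have e1 : ∀ p, w p * Real.log (abv p x') - (2 * n + 1) * (w p * Real.log (abv p x)) =
          w p * Real.log (abv p a₁) := fun p => by
        rw [ha₁, map_mul, map_pow, map_inv₀, Real.log_mul ((abv p).ne_zero hx')
          (pow_ne_zero _ (inv_ne_zero ((abv p).ne_zero hx))), Real.log_pow, Real.log_inv]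
        push_cast; ring
      have e2 : ∀ p, w p * Real.log (abv p y') - (2 * n + 1) * (w p * Real.log (abv p y)) =
          w p * Real.log (abv p a₂) := fun p => by
        rw [ha₂, map_mul, map_pow, map_inv₀, Real.log_mul ((abv p).ne_zero hy')
          (pow_ne_zero _ (inv_ne_zero ((abv p).ne_zero hy))), Real.log_pow, Real.log_inv]
        push_cast; ring
      simp [l, PiLp.norm_eq_of_L1, logSize, ← hyd, ← hyd', e1, e2, abs_mul, abs_of_nonneg (hw _)]
    rw [hlnorm, hdiff]
    simp only [mul_add, Finset.sum_add_distrib] at hsum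
    have s1 : ∑ p, w p * (n * m p) = n * ∑ p, w p * m p := by
      rw [Finset.mul_sum]; exact Finset.sum_congr rfl fun p _ => by ring
    have s2 : ∑ p, w p * (Real.log 128 * n) + ∑ p, w p * (Real.log 128 * 1) = C * (n + 1) := by
      rw [← Finset.sum_mul, ← Finset.sum_mul, hC]; ring
    have hDn := hprod _ hDR hD0
    have hn : (0 : ℝ) ≤ n := n.cast_nonneg
    have hcomb : n * (logSize abv w x + logSize abv w y) ≤ n * (4 * ∑ p, w p * m p) :=
      mul_le_mul_of_nonneg_left (by linarith) hn
    change _ ≤ _ + (logSize abv w a₁ : ℝ) + logSize abv w a₂ at hsum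
    linarith

end UnitEquation

section NumberField

variable {L : Type*} [Field L] [NumberField L]

/-- The ring of elements of `L` that are integral at every finite place outside `T`. -/
def integralOutside (T : Set (FinitePlace L)) : Subring L where
  carrier := {x | ∀ v : FinitePlace L, v ∉ T → v x ≤ 1}
  mul_mem' hx hy v hv := by
    rw [map_mul]
    exact mul_le_one₀ (hx v hv) (apply_nonneg v _) (hy v hv)
  one_mem' v _ := (map_one v).le
  add_mem' hx hy v hv := (FinitePlace.add_le v _ _).trans (max_le (hx v hv) (hy v hv))
  zero_mem' v _ := by simp
  neg_mem' hx v hv := by rw [map_neg_eq_map]; exact hx v hv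

/-- The infinite places together with the finite places in `T`, as absolute values. -/
def placesAbv (T : Set (FinitePlace L)) : InfinitePlace L ⊕ T → AbsoluteValue L ℝ :=
  Sum.elim (fun v => v.1) (fun v => v.1.1)

/-- The local degrees entering the product formula. -/
noncomputable def placesWeight (T : Set (FinitePlace L)) : InfinitePlace L ⊕ T → ℝ :=
  Sum.elim (fun v => (v.mult : ℝ)) (fun _ => 1)

theorem placesWeight_nonneg (T : Set (FinitePlace L)) (p : InfinitePlace L ⊕ T) :
    0 ≤ placesWeight T p := by
  rcases p with p | p <;> simp [placesWeight]

theorem sum_log_nonneg {T : Set (FinitePlace L)} [Fintype T] {x : L}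
    (hx : x ∈ integralOutside T) (hx0 : x ≠ 0) :
    0 ≤ ∑ p, placesWeight T p * Real.log (placesAbv T p x) := by
  classical
  have hT : T.Finite := Set.toFinite T
  have hmul := FinitePlace.hasFiniteMulSupport hx0
  set U : Finset (FinitePlace L) := hT.toFinset ∪ hmul.toFinset
  have hfin : ∏ᶠ v : FinitePlace L, v x = ∏ v ∈ U, v x :=
    finprod_eq_prod_of_mulSupport_subset _ fun _ hv =>
      Finset.mem_coe.2 (Finset.mem_union_right _ (hmul.mem_toFinset.2 hv))
  have hle : ∏ v ∈ U, v x ≤ ∏ v ∈ hT.toFinset, v x := by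
    rw [← Finset.prod_sdiff (Finset.subset_union_left : hT.toFinset ⊆ U)]
    refine mul_le_of_le_one_left (Finset.prod_nonneg fun v _ => apply_nonneg v x) ?_
    refine Finset.prod_le_one (fun v _ => apply_nonneg v x) fun v hv => hx v fun hvT => ?_
    exact (Finset.mem_sdiff.1 hv).2 (hT.mem_toFinset.2 hvT)
  have hformula := prod_abs_eq_one hx0
  rw [hfin] at hformula
  have hinf : 0 < ∏ w : InfinitePlace L, w x ^ w.mult :=
    Finset.prod_pos fun w _ => pow_pos (InfinitePlace.pos_iff.2 hx0) _
  have hone : 1 ≤ (∏ w : InfinitePlace L, w x ^ w.mult) * ∏ v ∈ hT.toFinset, v x := by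
    rw [← hformula]
    exact mul_le_mul_of_nonneg_left hle hinf.le
  have hlog := Real.log_nonneg hone
  have hpos : ∀ v : FinitePlace L, v x ≠ 0 := fun v => (FinitePlace.pos_iff.2 hx0).ne'
  rw [Real.log_mul hinf.ne' (Finset.prod_ne_zero_iff.2 fun v _ => hpos v),
    Real.log_prod fun w _ => pow_ne_zero _ (InfinitePlace.pos_iff.2 hx0).ne',
    Real.log_prod fun v _ => hpos v] at hlog
  rw [Fintype.sum_sum_type]
  convert hlog using 2
  · exact Finset.sum_congr rfl fun w _ => by
      rw [Real.log_pow]; rfl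
  · rw [Finset.sum_subtype hT.toFinset (p := (· ∈ T)) (fun v => hT.mem_toFinset)]
    refine Finset.sum_congr rfl fun v _ => ?_
    simp [placesWeight, placesAbv, FinitePlace.coe_apply]

theorem logHeight_le_logSize {T : Set (FinitePlace L)} [Fintype T] {x : L}
    (hx : x ∈ integralOutside T) :
    Height.logHeight₁ x ≤ logSize (placesAbv T) (placesWeight T) x := by
  classical
  have hT : T.Finite := Set.toFinite T
  have hle : ∀ r : ℝ, Real.posLog r ≤ |Real.log r| := fun r =>
    max_le (abs_nonneg _) (le_abs_self _)
  rw [logHeight₁_eq, logSize, Fintype.sum_sum_type]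
  refine add_le_add ?_ ?_
  · exact Finset.sum_le_sum fun w _ => mul_le_mul_of_nonneg_left (hle _) (Nat.cast_nonneg _)
  · rw [finsum_eq_sum_of_support_subset (s := hT.toFinset), ← Finset.sum_coe_sort]
    · refine (Finset.sum_le_sum fun v _ => hle _).trans_eq ?_
      refine Fintype.sum_equiv (Equiv.subtypeEquivRight fun v => by simp) _ _ fun v => ?_
      simp [placesWeight, placesAbv, FinitePlace.coe_apply]
    · intro v hv
      by_contra hvT
      rw [Set.Finite.coe_toFinset] at hvT
      refine hv (Real.posLog_eq_zero_iff _ |>.2 ?_)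
      rw [abs_of_nonneg (apply_nonneg v x)]
      exact hx v hvT

/-- Siegel's theorem on the unit equation: `x + y = 1` has finitely many solutions in `T`-units. -/
theorem finite_sUnit_equation {T : Set (FinitePlace L)} (hT : T.Finite) :
    {x : L | x ≠ 0 ∧ 1 - x ≠ 0 ∧ x ∈ integralOutside T ∧ x⁻¹ ∈ integralOutside T ∧
      (1 - x)⁻¹ ∈ integralOutside T}.Finite := by
  have := hT.fintype
  exact finite_unit_equation (placesAbv T) (placesWeight T) (placesWeight_nonneg T)
    (integralOutside T) (fun x hx hx0 => sum_log_nonneg hx hx0) fun B =>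
      (finite_setOfPred_logHeight₁_le L B).subset fun x hx => (logHeight_le_logSize hx.1).trans hx.2

end NumberField

section SUnits

variable {K : Type} [Field K] [NumberField K] {S : Set (HeightOneSpectrum (𝓞 K))}

/-- The group of `S`-units of a number field is finitely generated. -/
theorem fg_unit (hS : S.Finite) : Group.FG (S.unit K) := by
  have := hS.to_subtype
  rw [GroupFG.iff_add_fg, ← Module.Finite.iff_addGroup_fg, Module.finite_def]
  let φ : S.unit K →* (S → Multiplicative ℤ) :=
    (MonoidHom.pi fun v : S => v.1.valuationOfNeZero).comp (S.unit K).subtype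
  let f : Additive (S.unit K) →ₗ[ℤ] (S → ℤ) :=
    AddMonoidHom.toIntLinearMap (AddMonoidHom.mk' (fun x v => (φ x.toMul v).toAdd) fun x y => by
      ext v; simp)
  let u : (𝓞 K)ˣ →* S.unit K :=
    (Units.map (algebraMap (𝓞 K) K : 𝓞 K →* K)).codRestrict (S.unit K) fun x v _ => by
      rw [← v.valuationOfNeZero_eq, HeightOneSpectrum.valuation_of_unit_eq]; rfl
  let g : Additive (𝓞 K)ˣ →ₗ[ℤ] Additive (S.unit K) :=
    AddMonoidHom.toIntLinearMap u.toAdditive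
  refine Submodule.fg_of_fg_map_of_fg_inf_ker f (IsNoetherian.noetherian _) ?_
  have hker : (⊤ ⊓ LinearMap.ker f : Submodule ℤ (Additive (S.unit K))) ≤ Submodule.map g ⊤ := by
    rintro x ⟨-, hx⟩
    have hval : ∀ v : HeightOneSpectrum (𝓞 K), v.valuation K (x.toMul : Kˣ) = 1 := fun v => by
      by_cases hv : v ∈ S
      · have h : v.valuationOfNeZero (x.toMul : Kˣ) = 1 := congrFun hx ⟨v, hv⟩
        rw [← v.valuationOfNeZero_eq, h]; rfl
      · exact x.toMul.2 v hv
    obtain ⟨a, ha⟩ := HeightOneSpectrum.mem_integers_of_valuation_le_one K (x.toMul : Kˣ)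
      fun v => (hval v).le
    obtain ⟨b, hb⟩ := HeightOneSpectrum.mem_integers_of_valuation_le_one K
      ((x.toMul : Kˣ) : K)⁻¹ fun v => by rw [map_inv₀, hval, inv_one]
    have hab : a * b = 1 := FaithfulSMul.algebraMap_injective (𝓞 K) K (by
      rw [map_mul, ha, hb, map_one, mul_inv_cancel₀ (Units.ne_zero _)])
    refine ⟨Additive.ofMul ⟨a, b, hab, by rw [mul_comm, hab]⟩, trivial, ?_⟩
    exact Additive.toMul.injective (Subtype.ext (Units.ext ha))
  have hfg : (Submodule.map g ⊤).FG := Module.Finite.fg_top.map g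
  exact hfg.of_le hker

theorem isSUnit_coe (u : S.unit K) : IsSUnit S ((u : Kˣ) : K) :=
  ⟨Units.ne_zero _, fun v hv => (u.2 v hv).le, fun v hv => by
    rw [map_inv₀, u.2 v hv, inv_one]⟩

theorem IsSUnit.valuation_eq_one {x : K} (hx : IsSUnit S x) {v : HeightOneSpectrum (𝓞 K)}
    (hv : v ∉ S) : v.valuation K x = 1 := by
  refine le_antisymm (hx.2.1 v hv) ?_
  have h := hx.2.2 v hv
  rwa [map_inv₀, inv_le_one₀ (zero_lt_iff.2 ((Valuation.ne_zero_iff _).2 hx.1))] at h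

theorem IsSUnit.exists_coe_eq {x : K} (hx : IsSUnit S x) :
    ∃ u : S.unit K, ((u : Kˣ) : K) = x :=
  ⟨⟨Units.mk0 x hx.1, fun _ hv => hx.valuation_eq_one hv⟩, rfl⟩

theorem IsSUnit.inv {x : K} (hx : IsSUnit S x) : IsSUnit S x⁻¹ :=
  ⟨inv_ne_zero hx.1, hx.2.2, by rw [inv_inv]; exact hx.2.1⟩

theorem IsSUnit.mul {x y : K} (hx : IsSUnit S x) (hy : IsSUnit S y) : IsSUnit S (x * y) :=
  ⟨mul_ne_zero hx.1 hy.1, mul_mem hx.2.1 hy.2.1, by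
    rw [mul_inv]; exact mul_mem hx.2.2 hy.2.2⟩

/-- There are finitely many `S`-units modulo squares of `S`-units. -/
theorem exists_finite_isSUnit_mod_sq (hS : S.Finite) :
    ∃ R : Set K, R.Finite ∧ ∀ α, IsSUnit S α →
      ∃ ε, IsSUnit S ε ∧ ∃ r ∈ R, IsSUnit S r ∧ α = ε ^ 2 * r := by
  have := fg_unit (K := K) hS
  let H := (powMonoidHom 2 : S.unit K →* S.unit K).range
  have : H.FiniteIndex := Subgroup.finiteIndex_range_powMonoidHom_of_fg _ two_ne_zero
  refine ⟨Set.range fun q : S.unit K ⧸ H => ((q.out : Kˣ) : K), Set.finite_range _, fun α hα => ?_⟩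
  obtain ⟨u, rfl⟩ := hα.exists_coe_eq
  obtain ⟨⟨_, w, rfl⟩, hw⟩ := QuotientGroup.mk_out_eq_mul H u
  refine ⟨_, isSUnit_coe w⁻¹, _, ⟨(u : S.unit K ⧸ H), rfl⟩, isSUnit_coe _, ?_⟩
  simp only [hw, Subgroup.coe_mul, Units.val_mul, powMonoidHom_apply, Subgroup.coe_pow,
    Units.val_pow_eq_pow_val, Subgroup.coe_inv, Units.val_inv_eq_inv_val]
  field_simp

/-- A common denominator for `S`-integers, up to powers. -/
theorem exists_isIntegral_pow_mul (hS : S.Finite) :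
    ∃ t : K, t ≠ 0 ∧ IsIntegral ℤ t ∧ ∀ x ∈ S.integer K, ∃ m : ℕ, IsIntegral ℤ (t ^ m * x) := by
  have hex : ∀ v : HeightOneSpectrum (𝓞 K), ∃ a ∈ v.asIdeal, a ≠ 0 := fun v =>
    Submodule.exists_mem_ne_zero_of_ne_bot v.ne_bot
  choose a ha ha0 using hex
  set t : 𝓞 K := ∏ v ∈ hS.toFinset, a v
  have ht0 : t ≠ 0 := Finset.prod_ne_zero_iff.2 fun v _ => ha0 v
  have htS : ∀ v ∈ S, v.valuation K (t : K) < 1 := fun v hv =>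
    (v.valuation_lt_one_iff_mem t).2
      (Ideal.mem_of_dvd _ (Finset.dvd_prod_of_mem _ (hS.mem_toFinset.2 hv)) (ha v))
  refine ⟨t, by exact_mod_cast ht0, t.isIntegral_coe, fun x hx => ?_⟩
  have hev : ∀ᶠ m : ℕ in Filter.atTop, ∀ v ∈ S, v.valuation K ((t : K) ^ m * x) ≤ 1 := by
    refine (Filter.eventually_all_finite hS).2 fun v hv => ?_
    rcases eq_or_ne x 0 with rfl | hx0
    · simp
    have hvx : v.valuation K x ≠ 0 := (Valuation.ne_zero_iff _).2 hx0
    obtain ⟨m, hm⟩ := exists_pow_lt₀ (htS v hv) (Units.mk0 _ (inv_ne_zero hvx))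
    filter_upwards [Filter.eventually_ge_atTop m] with n hn
    rw [map_mul, map_pow]
    calc _ ≤ v.valuation K (t : K) ^ m * v.valuation K x := by
          gcongr ?_ * _
          exact pow_le_pow_right_of_le_one' (htS v hv).le hn
      _ ≤ (v.valuation K x)⁻¹ * v.valuation K x := by
          gcongr
          exact hm.le
      _ = 1 := inv_mul_cancel₀ hvx
  obtain ⟨m, hm⟩ := hev.exists
  refine ⟨m, ?_⟩
  obtain ⟨y, hy⟩ := HeightOneSpectrum.mem_integers_of_valuation_le_one (R := 𝓞 K) K (t ^ m * x)
    fun v => by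
      by_cases hv : v ∈ S
      · exact hm v hv
      · rw [map_mul, map_pow]
        exact mul_le_one' (pow_le_one' (v.valuation_le_one t) m) (hx v hv)
  rw [← hy]
  exact y.isIntegral_coe

theorem finitePlace_le_one_of_isIntegral {L : Type*} [Field L] [NumberField L] {x : L}
    (hx : IsIntegral ℤ x) (w : FinitePlace L) : w x ≤ 1 := by
  rw [← FinitePlace.norm_embedding_eq]
  exact FinitePlace.norm_le_one L w.maximalIdeal (⟨x, hx⟩ : 𝓞 L)

/-- Outside finitely many places of an extension, `S`-integers and a given nonzero integer `n` are
integral and a unit, respectively. -/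
theorem exists_finite_places (hS : S.Finite) (L : Type*) [Field L] [NumberField L] [Algebra K L]
    {n : ℕ} (hn : n ≠ 0) :
    ∃ T : Set (FinitePlace L), T.Finite ∧
      (∀ x ∈ S.integer K, algebraMap K L x ∈ integralOutside T) ∧ (n : L)⁻¹ ∈ integralOutside T := by
  obtain ⟨t, ht0, hti, ht⟩ := exists_isIntegral_pow_mul hS
  have hmap : ∀ {y : K}, IsIntegral ℤ y → IsIntegral ℤ (algebraMap K L y) := fun hy =>
    hy.map ((algebraMap K L).toIntAlgHom)
  have ht0' : algebraMap K L t ≠ 0 := (map_ne_zero _).2 ht0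
  refine ⟨{w | w (algebraMap K L t) ≠ 1} ∪ {w | w (n : L) ≠ 1},
    (FinitePlace.hasFiniteMulSupport ht0').union
      (FinitePlace.hasFiniteMulSupport (Nat.cast_ne_zero.2 hn)),
    fun x hx w hw => ?_, fun w hw => ?_⟩
  · have hwt : w (algebraMap K L t) = 1 := by
      by_contra h
      exact hw (Or.inl h)
    obtain ⟨m, hm⟩ := ht x hx
    have := finitePlace_le_one_of_isIntegral (hmap hm) w
    rwa [map_mul, map_pow, map_mul, map_pow, hwt, one_pow, one_mul] at this
  · have hwn : w (n : L) = 1 := by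
      by_contra h
      exact hw (Or.inr h)
    rw [map_inv₀, hwn, inv_one]

/-- Reduction of `γ ^ 2 - α = β` to the unit equation in an extension containing `√α`. -/
theorem finite_sq_sub_isSUnit_of_sq_eq (hS : S.Finite) {α : K} (hα : IsSUnit S α) {L : Type*}
    [Field L] [NumberField L] [Algebra K L] {δ : L} (hδ : δ ^ 2 = algebraMap K L α) :
    {γ : K | γ ∈ S.integer K ∧ IsSUnit S (γ ^ 2 - α)}.Finite := by
  obtain ⟨T, hT, hint, htwo⟩ := exists_finite_places hS L two_ne_zero
  have hα0 : algebraMap K L α ≠ 0 := (map_ne_zero _).2 hα.1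
  have hδ0 : δ ≠ 0 := by
    rintro rfl
    exact hα0 (by rw [← hδ]; simp)
  have hsq : ∀ y : L, y ^ 2 ∈ integralOutside T → y ∈ integralOutside T := fun y hy w hw => by
    have := hy w hw
    rwa [map_pow, sq_le_one_iff₀ (apply_nonneg w y)] at this
  have hδ1 : δ ∈ integralOutside T := hsq δ (hδ ▸ hint α hα.2.1)
  have hδ2 : δ⁻¹ ∈ integralOutside T := hsq _ (by
    rw [inv_pow, hδ, ← map_inv₀]
    exact hint _ hα.2.2)
  have hinj : Function.Injective fun γ : K => (algebraMap K L γ + δ) * (2 : L)⁻¹ * δ⁻¹ :=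
    fun γ γ' h => (algebraMap K L).injective (by
      have h2 : (2 : L) ≠ 0 := two_ne_zero
      simpa [h2, hδ0] using h)
  refine Set.Finite.of_finite_image ((finite_sUnit_equation hT).subset ?_) hinj.injOn
  rintro _ ⟨γ, ⟨hγ, hβ⟩, rfl⟩
  have hγL := hint γ hγ
  have hβinv := hint _ hβ.2.2
  have hβ0 : algebraMap K L (γ ^ 2 - α) ≠ 0 := (map_ne_zero _).2 hβ.1
  rw [map_inv₀] at hβinv
  set c := algebraMap K L γ
  set b := algebraMap K L (γ ^ 2 - α)
  have hb : b = (c + δ) * (c - δ) := by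
    simp only [b, c, map_sub, map_pow, ← hδ]
    ring
  have hplus : c + δ ≠ 0 := fun h => hβ0 (by rw [hb, h, zero_mul])
  have hminus : c - δ ≠ 0 := fun h => hβ0 (by rw [hb, h, mul_zero])
  have h2 : (2 : L) ∈ integralOutside T := ofNat_mem _ 2
  have htwo' : (2 : L)⁻¹ ∈ integralOutside T := by exact_mod_cast htwo
  have hone : 1 - (c + δ) * (2 : L)⁻¹ * δ⁻¹ = -(c - δ) * (2 : L)⁻¹ * δ⁻¹ := by
    field_simp
    ring
  refine ⟨mul_ne_zero (mul_ne_zero hplus (inv_ne_zero two_ne_zero)) (inv_ne_zero hδ0), ?_,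
    mul_mem (mul_mem (add_mem hγL hδ1) htwo') hδ2, ?_, ?_⟩
  · rw [hone]
    exact mul_ne_zero (mul_ne_zero (neg_ne_zero.2 hminus) (inv_ne_zero two_ne_zero))
      (inv_ne_zero hδ0)
  · have : ((c + δ) * (2 : L)⁻¹ * δ⁻¹)⁻¹ = 2 * δ * (c - δ) * b⁻¹ := by
      rw [hb]
      field_simp
    rw [this]
    exact mul_mem (mul_mem (mul_mem h2 hδ1) (sub_mem hγL hδ1)) hβinv
  · have : (1 - (c + δ) * (2 : L)⁻¹ * δ⁻¹)⁻¹ = -(2 * δ * (c + δ) * b⁻¹) := by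
      rw [hone, hb]
      field_simp
    rw [this]
    exact neg_mem (mul_mem (mul_mem (mul_mem h2 hδ1) (add_mem hγL hδ1)) hβinv)

/-- For a fixed `S`-unit `α`, only finitely many `S`-integers `γ` make `γ² - α` an `S`-unit. -/
theorem finite_sq_sub_isSUnit (hS : S.Finite) {α : K} (hα : IsSUnit S α) :
    {γ : K | γ ∈ S.integer K ∧ IsSUnit S (γ ^ 2 - α)}.Finite := by
  let f : Polynomial K := Polynomial.X ^ 2 - Polynomial.C α
  let L := f.SplittingField
  have : NumberField L := NumberField.of_module_finite K L
  obtain ⟨δ, hδ⟩ : ∃ δ : L, δ ^ 2 = algebraMap K L α := by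
    obtain ⟨δ, hδ⟩ := (Polynomial.SplittingField.splits f).exists_eval_eq_zero (by
      rw [Polynomial.degree_map, Polynomial.degree_X_pow_sub_C two_pos]; norm_num)
    refine ⟨δ, ?_⟩
    simpa [f, sub_eq_zero] using hδ
  exact finite_sq_sub_isSUnit_of_sq_eq hS hα hδ

end SUnits

theorem stmt_16
    (K : Type) [Field K] [NumberField K]
    (S : Set (HeightOneSpectrum (𝓞 K))) (hSfin : S.Finite) :
    -- the set of solutions of `α + β = γ²` has finitely many classes under the scaling relation
    Finite (Quot (SolRel (S := S) (i := 2))) := by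
  obtain ⟨R, hR, hrep⟩ := exists_finite_isSUnit_mod_sq (K := K) hSfin
  have hF : (⋃ r ∈ {r ∈ R | IsSUnit S r},
      (fun γ => (r, γ ^ 2 - r, γ)) '' {γ : K | γ ∈ S.integer K ∧ IsSUnit S (γ ^ 2 - r)}).Finite :=
    (hR.subset (Set.sep_subset _ _)).biUnion fun r hr =>
      (finite_sq_sub_isSUnit hSfin hr.2).image _
  have hfin := hF.preimage (f := fun s : SolSet S 2 => s.1) Subtype.val_injective.injOn
  refine Set.finite_univ_iff.1 ((hfin.image (Quot.mk SolRel)).subset fun q _ => ?_)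
  obtain ⟨⟨⟨α, β, γ⟩, hα, hβ, hγ, h⟩, rfl⟩ := Quot.exists_rep q
  obtain ⟨ε, hε, r, hrR, hr, rfl⟩ := hrep α hα
  have hε0 : ε ≠ 0 := hε.1
  have hβ' : IsSUnit S (ε⁻¹ * ε⁻¹ * β) := (hε.inv.mul hε.inv).mul hβ
  have hγ' : ε⁻¹ * γ ∈ S.integer K := mul_mem hε.2.2 hγ
  have h' : r + ε⁻¹ * ε⁻¹ * β = (ε⁻¹ * γ) ^ 2 := by
    rw [mul_pow, ← h]
    field_simp
  refine ⟨⟨(r, ε⁻¹ * ε⁻¹ * β, ε⁻¹ * γ), hr, hβ', hγ', h'⟩, ?_, Quot.sound ⟨ε, hε, ?_⟩⟩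
  · have hsub : (ε⁻¹ * γ) ^ 2 - r = ε⁻¹ * ε⁻¹ * β := by rw [← h', add_sub_cancel_left]
    exact Set.mem_biUnion ⟨hrR, hr⟩ ⟨ε⁻¹ * γ, ⟨hγ', hsub ▸ hβ'⟩, 
      Prod.ext rfl (Prod.ext hsub rfl)⟩
  · refine ⟨rfl, ?_, ?_⟩
    · field_simp
    · field_simp
end

section
/- Let K be a totally real number field of degree n, let ω be a primitive cube root of unity, and set F = ℚ(ω) and L = K(ω). Let q ≥ 5 be a rational prime that is totally ramified in K and inert in F, so that q̃ := q·O_F is a prime ideal of O_F and there is a unique prime ideal 𝔮 of O_L above q, satisfying q·O_L = 𝔮ⁿ. Then for every λ ∈ O_L there exists b ∈ O_F = ℤ[ω] such that λ ≡ b (mod 𝔮) and Norm_{L/F}(λ) ≡ bⁿ (mod q̃). -/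
open NumberField

theorem finrank_le_two_of_adjoin_cubeRoot (K L : Type*) [Field K] [Field L] [Algebra K L]
    (ω : L) (hω : IsPrimitiveRoot ω 3) (hL : Algebra.adjoin K {ω} = ⊤) :
    Module.finrank K L ≤ 2 := by
  have h0 : Polynomial.aeval ω (Polynomial.cyclotomic 3 K) = 0 := by
    rw [← Polynomial.eval_map_algebraMap, Polynomial.map_cyclotomic]
    exact hω.isRoot_cyclotomic (by norm_num)
  have hint : IsIntegral K ω := ⟨_, Polynomial.cyclotomic.monic 3 K, h0⟩
  have htop : IntermediateField.adjoin K {ω} = ⊤ :=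
    IntermediateField.adjoin_eq_top_of_algebra K {ω} hL
  rw [← IntermediateField.finrank_top', ← htop, IntermediateField.adjoin.finrank hint]
  refine (Polynomial.natDegree_le_of_dvd (minpoly.dvd K ω h0)
    (Polynomial.cyclotomic_ne_zero 3 K)).trans ?_
  rw [Polynomial.natDegree_cyclotomic]
  decide

theorem absNorm_span_natCast_ringOfIntegers (K : Type*) [Field K] [NumberField K] (q : ℕ) :
    Ideal.absNorm (Ideal.span {(q : 𝓞 K)}) = q ^ Module.finrank ℚ K := by
  rw [Ideal.absNorm_span_natCast, RingOfIntegers.rank]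

/-- An injection of residue rings is a bijection as soon as the absolute norms allow it. -/
theorem quotientMap_bijective_of_absNorm_le {R S : Type*}
    [CommRing R] [IsDedekindDomain R] [Module.Free ℤ R]
    [CommRing S] [IsDedekindDomain S] [Module.Free ℤ S] [Module.Finite ℤ S]
    (f : R →+* S) (J : Ideal S) (hJ : J ≠ ⊥) (h : J.absNorm ≤ (J.comap f).absNorm) :
    Function.Bijective (Ideal.quotientMap J f le_rfl) := by
  have := Ideal.finiteQuotientOfFreeOfNeBot J hJ
  refine Ideal.quotientMap_injective.bijective_of_nat_card_le ?_
  rwa [Ideal.absNorm_apply, Ideal.absNorm_apply] at h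

/-- If a power of `lam - b` is divisible by `q`, then the relative norm of `lam` is congruent
to a power of `b` modulo the prime generated by `q`. -/
theorem norm_sub_pow_mem_of_pow_sub_mem (F L : Type*) [Field F] [NumberField F]
    [Field L] [NumberField L] [Algebra F L] (q : 𝓞 F) (hq : (Ideal.span {q}).IsPrime)
    (lam : 𝓞 L) (b : 𝓞 F) (m : ℕ)
    (h : (lam - algebraMap (𝓞 F) (𝓞 L) b) ^ m ∈ Ideal.span {algebraMap (𝓞 F) (𝓞 L) q}) :
    RingOfIntegers.norm F lam - b ^ Module.finrank F L ∈ Ideal.span {q} := by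
  let E := AlgebraicClosure F
  let C := integralClosure (𝓞 F) E
  obtain ⟨P, -, hP, hPq⟩ := Ideal.exists_ideal_over_prime_of_isIntegral (S := C)
    (Ideal.span {q}) ⊥ (by
      rw [← RingHom.ker_eq_comap_bot,
        (RingHom.injective_iff_ker_eq_bot _).1 (FaithfulSMul.algebraMap_injective (𝓞 F) C)]
      exact bot_le)
  let φ (σ : L →ₐ[F] E) : 𝓞 L →ₐ[𝓞 F] C :=
    ((σ.restrictScalars (𝓞 F)).comp (IsScalarTower.toAlgHom (𝓞 F) (𝓞 L) L)).codRestrict C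
      fun x => (Algebra.IsIntegral.isIntegral x).map
        ((σ.restrictScalars (𝓞 F)).comp (IsScalarTower.toAlgHom (𝓞 F) (𝓞 L) L))
  have hφ (σ : L →ₐ[F] E) : φ σ lam - algebraMap (𝓞 F) C b ∈ P := by
    refine hP.mem_of_pow_mem m ?_
    obtain ⟨c, hc⟩ := Ideal.mem_span_singleton'.1 h
    have hqP : algebraMap (𝓞 F) C q ∈ P := by
      rw [← Ideal.mem_comap, hPq]
      exact Ideal.mem_span_singleton_self q
    have key := congrArg (φ σ) hc
    simp only [map_mul, map_pow, map_sub, AlgHom.commutes] at key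
    rw [← key]
    exact P.mul_mem_left _ hqP
  have hprod : algebraMap (𝓞 F) C (RingOfIntegers.norm F lam) = ∏ σ : L →ₐ[F] E, φ σ lam := by
    apply Subtype.ext
    have h1 := Algebra.norm_eq_prod_embeddings F E (lam : L)
    rw [← RingOfIntegers.coe_norm] at h1
    rw [← Subalgebra.val_apply, ← Subalgebra.val_apply, map_prod]
    exact h1
  rw [← hPq, Ideal.mem_comap, map_sub, map_pow, hprod, ← AlgHom.card F L E, ← Ideal.Quotient.eq,
    map_prod, map_pow, Finset.prod_congr rfl fun σ _ => Ideal.Quotient.eq.2 (hφ σ),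
    Finset.prod_const, Finset.card_univ]

theorem stmt_18
    (K F L : Type) [Field K] [NumberField K] [Field F] [NumberField F]
    [Field L] [NumberField L] [Algebra K L] [Algebra F L]
    -- `K` is totally real of degree `n`
    (htotreal : ∀ v : InfinitePlace K, v.IsReal)
    (n : ℕ) (hn : Module.finrank ℚ K = n)
    -- `F = ℚ(ω)` where `ω` is a primitive cube root of unity
    (ωF : F) (hωF : IsPrimitiveRoot ωF 3) (hFdeg : Module.finrank ℚ F = 2)
    -- `L = K(ω)` where `ω` is the image of `ωF` in `L`
    (ω : L) (hω : algebraMap F L ωF = ω) (hL : Algebra.adjoin K {ω} = ⊤)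
    (q : ℕ) (hq : q.Prime) (hq5 : 5 ≤ q)
    -- `q` is totally ramified in `K`
    (hramK : ∃ Q : Ideal (𝓞 K), Q.IsPrime ∧ Ideal.span {(q : 𝓞 K)} = Q ^ n)
    -- `q` is inert in `F`, so `q̃ = q·O_F` is a prime ideal
    (hqF : (Ideal.span {(q : 𝓞 F)}).IsPrime)
    -- `𝔮` is the (unique) prime of `O_L` above `q`, and `q·O_L = 𝔮ⁿ`
    (𝔮 : Ideal (𝓞 L)) (h𝔮 : 𝔮.IsPrime) (hramL : Ideal.span {(q : 𝓞 L)} = 𝔮 ^ n) :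
    ∀ lam : 𝓞 L, ∃ b : 𝓞 F,
      -- `λ ≡ b (mod 𝔮)`
      lam - algebraMap (𝓞 F) (𝓞 L) b ∈ 𝔮 ∧
      -- `Norm_{L/F}(λ) ≡ bⁿ (mod q̃)`
      ∃ Nlam : 𝓞 F, algebraMap (𝓞 F) F Nlam = Algebra.norm F (algebraMap (𝓞 L) L lam) ∧
        Nlam - b ^ n ∈ Ideal.span {(q : 𝓞 F)} := by
  have hn0 : n ≠ 0 := hn ▸ Module.finrank_pos.ne'
  have hωL : IsPrimitiveRoot ω 3 := hω ▸ hωF.map_of_injective (algebraMap F L).injective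
  have hdeg : Module.finrank ℚ L ≤ n * 2 := by
    rw [← Module.finrank_mul_finrank ℚ K L, hn]
    exact Nat.mul_le_mul_left n (finrank_le_two_of_adjoin_cubeRoot K L ω hωL hL)
  have hqmem : (q : 𝓞 L) ∈ 𝔮 :=
    Ideal.pow_le_self hn0 (hramL ▸ Ideal.mem_span_singleton_self _)
  have hq0 : (q : 𝓞 F) ≠ 0 := Nat.cast_ne_zero.2 hq.ne_zero
  have hcomap : Ideal.span {(q : 𝓞 F)} = 𝔮.comap (algebraMap (𝓞 F) (𝓞 L)) := by
    refine (hqF.isMaximal (by simpa using hq0)).eq_of_le (h𝔮.comap _).ne_top ?_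
    rw [Ideal.span_singleton_le_iff_mem, Ideal.mem_comap, map_natCast]
    exact hqmem
  have h𝔮0 : 𝔮 ≠ ⊥ := by
    rintro rfl
    exact hq.ne_zero (Nat.cast_eq_zero.1 ((Ideal.mem_bot).1 hqmem))
  have hnorm : 𝔮.absNorm ^ n = q ^ Module.finrank ℚ L := by
    rw [← map_pow, ← hramL, absNorm_span_natCast_ringOfIntegers]
  have hnormF : (𝔮.comap (algebraMap (𝓞 F) (𝓞 L))).absNorm = q ^ 2 := by
    rw [← hcomap, absNorm_span_natCast_ringOfIntegers, hFdeg]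
  have hbij := quotientMap_bijective_of_absNorm_le (algebraMap (𝓞 F) (𝓞 L)) 𝔮 h𝔮0 (by
    rw [hnormF, ← Nat.pow_le_pow_iff_left hn0, hnorm, ← pow_mul, mul_comm]
    exact Nat.pow_le_pow_right hq.pos hdeg)
  have hcard : 𝔮.absNorm = q ^ 2 := by
    rw [← hnormF, Ideal.absNorm_apply, Ideal.absNorm_apply]
    exact (Nat.card_congr (Equiv.ofBijective _ hbij)).symm
  have hrank : Module.finrank F L = n := by
    rw [hcard, ← pow_mul, ← Module.finrank_mul_finrank ℚ F L, hFdeg] at hnorm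
    exact (Nat.eq_of_mul_eq_mul_left two_pos (Nat.pow_right_injective hq.two_le hnorm)).symm
  intro lam
  obtain ⟨y, hy⟩ := hbij.2 (Ideal.Quotient.mk 𝔮 lam)
  obtain ⟨b, rfl⟩ := Ideal.Quotient.mk_surjective y
  rw [Ideal.quotientMap_mk] at hy
  have hb := Ideal.Quotient.eq.1 hy.symm
  refine ⟨b, hb, RingOfIntegers.norm F lam, RingOfIntegers.coe_norm F lam, ?_⟩
  have := norm_sub_pow_mem_of_pow_sub_mem F L (q : 𝓞 F) hqF lam b n (by
    rw [map_natCast, hramL]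
    exact Ideal.pow_mem_pow hb n)
  rwa [hrank] at this
end

section
/- Let K be a totally real number field of degree n, let ω be a primitive cube root of unity, and set F = ℚ(ω) and L = K(ω). Let q ≥ 5 be a rational prime that is totally ramified in K and inert in F, and let 𝔮 be the unique prime ideal of O_L above q, so q·O_L = 𝔮ⁿ. Assume gcd(n, q² − 1) = 1. Then every unit λ ∈ O_L^* is congruent modulo 𝔮 to an element of the cyclic group generated by ω + 1, i.e. λ ≡ u (mod 𝔮) for some u ∈ {1, −1, ω + 1, −(ω + 1), ω, −ω}. -/
open NumberField

/-- The norm of an element congruent to `1` modulo `r` is congruent to `1` modulo `r`. -/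
theorem Algebra.dvd_norm_one_add_smul_sub_one {R S : Type*} [CommRing R] [CommRing S]
    [Algebra R S] [Module.Free R S] [Module.Finite R S] (r : R) (x : S) :
    r ∣ Algebra.norm R (1 + r • x) - 1 := by
  classical
  let b := Module.Free.chooseBasis R S
  rw [Algebra.norm_eq_matrix_det b, ← Ideal.mem_span_singleton,
    ← Ideal.Quotient.mk_eq_mk_iff_sub_mem, RingHom.map_det, map_one, map_add, map_one, map_smul]
  have hr : Ideal.Quotient.mk (Ideal.span {r}) r = 0 :=
    Ideal.Quotient.eq_zero_iff_mem.2 (Ideal.mem_span_singleton_self r)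
  rw [← Matrix.det_one (n := Module.Free.ChooseBasisIndex R S)]
  congr 1
  ext i j
  rcases eq_or_ne i j with rfl | h
  · simp [hr]
  · simp [hr, h]

/-- An element congruent to `1` modulo an ideal, one of whose powers is contained in `(p)`, has a
`p`-power power that is congruent to `1` modulo `p`. -/
theorem exists_pow_prime_pow_eq_one_add_mul {R : Type*} [CommRing R] {p : ℕ} (hp : p.Prime)
    {I : Ideal R} {n : ℕ} (hI : I ^ n ≤ Ideal.span {(p : R)}) {x : R} (hx : x - 1 ∈ I) :
    ∃ y, x ^ p ^ n = 1 + p * y := by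
  obtain ⟨r, hr⟩ := exists_add_pow_prime_pow_eq hp (x - 1) 1 n
  have hmem : (x - 1) ^ p ^ n ∈ Ideal.span {(p : R)} :=
    hI (Ideal.pow_le_pow_right (Nat.lt_pow_self hp.one_lt).le (Ideal.pow_mem_pow hx _))
  obtain ⟨s, hs⟩ := Ideal.mem_span_singleton.1 hmem
  refine ⟨s + (x - 1) * r, ?_⟩
  rw [sub_add_cancel] at hr
  rw [hr, hs]
  ring

/-- A quadratic number field containing a primitive cube root of unity is the third cyclotomic
field. -/
theorem IsPrimitiveRoot.isCyclotomicExtension_three_of_finrank_eq_two {F : Type*} [Field F]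
    [NumberField F] {ζ : F} (hζ : IsPrimitiveRoot ζ 3) (hF : Module.finrank ℚ F = 2) :
    IsCyclotomicExtension {3} ℚ F := by
  have hdeg : Module.finrank ℚ (IntermediateField.adjoin ℚ {ζ}) = 2 := by
    rw [IntermediateField.adjoin.finrank (IsIntegral.of_finite ℚ ζ),
      ← Polynomial.cyclotomic_eq_minpoly_rat hζ (by norm_num), Polynomial.natDegree_cyclotomic]
    rfl
  have htop : IntermediateField.adjoin ℚ {ζ} = ⊤ :=
    IntermediateField.eq_of_le_of_finrank_eq le_top
      (by rw [hdeg, IntermediateField.finrank_top', hF])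
  have := hζ.intermediateField_adjoin_isCyclotomicExtension ℚ
  rw [htop] at this
  exact IsCyclotomicExtension.equiv {3} ℚ _ IntermediateField.topEquiv

/-- Units of the ring of integers of the third cyclotomic field are sixth roots of unity. -/
theorem IsPrimitiveRoot.unit_pow_six_eq_one {F : Type*} [Field F] [NumberField F]
    [IsCyclotomicExtension {3} ℚ F] {ζ : F} (hζ : IsPrimitiveRoot ζ 3) (u : (𝓞 F)ˣ) :
    u ^ 6 = 1 := by
  have h3 : (hζ.toInteger_isPrimitiveRoot.isUnit (by decide)).unit ^ 3 = 1 := by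
    ext1
    simpa using hζ.toInteger_isPrimitiveRoot.pow_eq_one
  have hmem := IsCyclotomicExtension.Rat.Three.Units.mem hζ u
  generalize (hζ.toInteger_isPrimitiveRoot.isUnit (by decide)).unit = η at h3 hmem
  have h6 : η ^ 6 = 1 := by rw [show 6 = 3 * 2 from rfl, pow_mul, h3, one_pow]
  have h12 : (η ^ 2) ^ 6 = 1 := by rw [← pow_mul, mul_comm, pow_mul, h6, one_pow]
  have heven : Even 6 := by decide
  simp only [List.mem_cons, List.not_mem_nil, or_false] at hmem
  rcases hmem with rfl | rfl | rfl | rfl | rfl | rfl <;>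
    simp only [heven.neg_pow, one_pow, h6, h12]

/-- Adjoining a root of `X ^ 2 + X + 1` gives an extension of degree at most two. -/
theorem Module.finrank_le_two_of_adjoin_eq_top {K L : Type*} [Field K] [Field L]
    [Algebra K L] [FiniteDimensional K L] {ζ : L} (hζ : ζ ^ 2 + ζ + 1 = 0)
    (hL : Algebra.adjoin K {ζ} = ⊤) : Module.finrank K L ≤ 2 := by
  have hint : IsIntegral K ζ := .of_finite K ζ
  have htop : IntermediateField.adjoin K {ζ} = ⊤ := by
    rw [← IntermediateField.toSubalgebra_inj,
      IntermediateField.adjoin_simple_toSubalgebra_of_isAlgebraic hint.isAlgebraic, hL]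
    rfl
  have hfin : Module.finrank K L = (minpoly K ζ).natDegree := by
    rw [← IntermediateField.adjoin.finrank hint, htop, IntermediateField.finrank_top']
  have hdvd : minpoly K ζ ∣ Polynomial.X ^ 2 + Polynomial.X + 1 :=
    minpoly.dvd K ζ (by simpa using hζ)
  have hdeg : (Polynomial.X ^ 2 + Polynomial.X + 1 : Polynomial K).natDegree = 2 := by
    compute_degree!
  rw [hfin, ← hdeg]
  exact Polynomial.natDegree_le_of_dvd hdvd
    (Polynomial.ne_zero_of_natDegree_gt (n := 0) (by rw [hdeg]; exact two_pos))

/-- In a domain with a root `w` of `X ^ 2 + X + 1`, the sixth roots of unity are `±1`, `±(w + 1)`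
and `±w`. -/
theorem eq_of_pow_six_eq_one {k : Type*} [CommRing k] [IsDomain k] {w x : k}
    (hw : w ^ 2 + w + 1 = 0) (hx : x ^ 6 = 1) :
    x = 1 ∨ x = -1 ∨ x = w + 1 ∨ x = -(w + 1) ∨ x = w ∨ x = -w := by
  have h : (x - 1) * ((x + 1) * ((x - (w + 1)) * ((x + (w + 1)) * ((x - w) * (x + w))))) = 0 := by
    have h1 : (x - (w + 1)) * (x + w) = x ^ 2 - x + 1 := by linear_combination -hw
    have h2 : (x + (w + 1)) * (x - w) = x ^ 2 + x + 1 := by linear_combination -hw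
    calc _ = (x - 1) * (x + 1) * ((x - (w + 1)) * (x + w)) * ((x + (w + 1)) * (x - w)) := by ring
      _ = x ^ 6 - 1 := by rw [h1, h2]; ring
      _ = 0 := by rw [hx, sub_self]
  simpa only [mul_eq_zero, sub_eq_zero, add_eq_zero_iff_eq_neg] using h

theorem stmt_19
    (K F L : Type) [Field K] [NumberField K] [Field F] [NumberField F]
    [Field L] [NumberField L] [Algebra K L] [Algebra F L]
    -- `K` is totally real of degree `n`
    (htotreal : ∀ v : InfinitePlace K, v.IsReal)
    (n : ℕ) (hn : Module.finrank ℚ K = n)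
    -- `F = ℚ(ω)` where `ω` is a primitive cube root of unity
    (ωF : F) (hωF : IsPrimitiveRoot ωF 3) (hFdeg : Module.finrank ℚ F = 2)
    -- `L = K(ω)` where `ω` is the image of `ωF` in `L`
    (ω : L) (hω : algebraMap F L ωF = ω) (hL : Algebra.adjoin K {ω} = ⊤)
    -- `ωI` is `ω` viewed as an element of `O_L`
    (ωI : 𝓞 L) (hωI : algebraMap (𝓞 L) L ωI = ω)
    (q : ℕ) (hq : q.Prime) (hq5 : 5 ≤ q)
    -- `q` is totally ramified in `K`
    (hramK : ∃ Q : Ideal (𝓞 K), Q.IsPrime ∧ Ideal.span {(q : 𝓞 K)} = Q ^ n)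
    -- `q` is inert in `F`
    (hqF : (Ideal.span {(q : 𝓞 F)}).IsPrime)
    -- `𝔮` is the (unique) prime of `O_L` above `q`, and `q·O_L = 𝔮ⁿ`
    (𝔮 : Ideal (𝓞 L)) (h𝔮 : 𝔮.IsPrime) (hramL : Ideal.span {(q : 𝓞 L)} = 𝔮 ^ n)
    -- `gcd(n, q² - 1) = 1`
    (hgcd : Nat.gcd n (q ^ 2 - 1) = 1) :
    -- every unit of `O_L` is congruent mod `𝔮` to an element of `⟨ω + 1⟩ = {±1, ±(ω+1), ±ω}`
    ∀ lam : (𝓞 L)ˣ, ∃ u ∈ ({1, -1, ωI + 1, -(ωI + 1), ωI, -ωI} : Set (𝓞 L)),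
      (lam : 𝓞 L) - u ∈ 𝔮 := by
  subst hn hω
  have hcyc := hωF.isCyclotomicExtension_three_of_finrank_eq_two hFdeg
  have := IsCyclotomicExtension.Rat.three_pid F
  have hwI : ωI ^ 2 + ωI + 1 = 0 := by
    have h := (hωF.map_of_injective (algebraMap F L).injective).isRoot_cyclotomic (by norm_num)
    simp only [Polynomial.cyclotomic_three, Polynomial.IsRoot.def, Polynomial.eval_add,
      Polynomial.eval_pow, Polynomial.eval_X, Polynomial.eval_one] at h
    apply RingOfIntegers.coe_injective
    simpa [hωI] using h
  -- the degree of `L / F`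
  have hLK : Module.finrank K L ≤ 2 := by
    refine Module.finrank_le_two_of_adjoin_eq_top ?_ hL
    rw [← hωI]
    simpa using congrArg (algebraMap (𝓞 L) L) hwI
  have hKpos : 0 < Module.finrank ℚ K := Module.finrank_pos
  have hLpos : 0 < Module.finrank K L := Module.finrank_pos
  have hodd : ¬ 2 ∣ Module.finrank ℚ K := by
    intro h
    have hq2 : 2 ∣ q ^ 2 - 1 := by
      have : q % 2 = 1 := hq.eq_two_or_odd.resolve_left (by omega)
      have h2 : q ^ 2 % 2 = 1 := by simp [Nat.pow_mod, this]
      omega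
    have := Nat.dvd_gcd h hq2
    omega
  have htower : 2 * Module.finrank F L = Module.finrank ℚ K * Module.finrank K L := by
    rw [Module.finrank_mul_finrank ℚ K L, ← hFdeg, Module.finrank_mul_finrank ℚ F L]
  have hLK2 : Module.finrank K L = 2 := by
    have h2 := (Nat.prime_two.dvd_mul.1 (Dvd.intro _ htower)).resolve_left hodd
    exact le_antisymm hLK (Nat.le_of_dvd hLpos h2)
  have hLF : Module.finrank F L = Module.finrank ℚ K := by
    rw [hLK2] at htower
    omega
  have hLQ : Module.finrank ℚ L = 2 * Module.finrank ℚ K := by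
    rw [← Module.finrank_mul_finrank ℚ K L, hLK2, mul_comm]
  have hrank : Module.finrank (𝓞 F) (𝓞 L) = Module.finrank ℚ K := by
    rw [← hLF, IsFractionRing.finrank_eq (𝓞 F) F (𝓞 L) L]
  generalize Module.finrank ℚ K = n at *
  -- the residue fields
  have hcardL : Nat.card (𝓞 L ⧸ 𝔮) = q ^ 2 := by
    have h := congrArg Ideal.absNorm hramL
    rw [map_pow, Ideal.absNorm_span_natCast, RingOfIntegers.rank, hLQ, pow_mul] at h
    exact (Nat.pow_left_injective hKpos.ne' h).symm
  have hcardF : Nat.card (𝓞 F ⧸ Ideal.span {(q : 𝓞 F)}) = q ^ 2 := by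
    have h := Ideal.absNorm_span_natCast (S := 𝓞 F) q
    rwa [RingOfIntegers.rank, hFdeg] at h
  have hfinL : Finite (𝓞 L ⧸ 𝔮) :=
    Nat.finite_of_card_ne_zero (by rw [hcardL]; exact pow_ne_zero _ hq.ne_zero)
  let := Fintype.ofFinite (𝓞 L ⧸ 𝔮)
  have hq𝔮 : (q : 𝓞 L) ∈ 𝔮 :=
    Ideal.pow_le_self hKpos.ne' (hramL ▸ Ideal.mem_span_singleton_self (q : 𝓞 L))
  have h𝔮max : 𝔮.IsMaximal := h𝔮.isMaximal (Submodule.ne_bot_iff _ |>.2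
    ⟨q, hq𝔮, Nat.cast_ne_zero.2 hq.ne_zero⟩)
  let := Ideal.Quotient.field 𝔮
  have hcard : Fintype.card (𝓞 L ⧸ 𝔮) = q ^ 2 := by rw [← Nat.card_eq_fintype_card, hcardL]
  let φ : 𝓞 F →+* 𝓞 L ⧸ 𝔮 := (Ideal.Quotient.mk 𝔮).comp (algebraMap (𝓞 F) (𝓞 L))
  have hφq : φ q = 0 := by
    simpa [φ] using Ideal.Quotient.eq_zero_iff_mem.2 hq𝔮
  have hφ : Function.Surjective φ := by
    have hmax : (Ideal.span {(q : 𝓞 F)}).IsMaximal :=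
      hqF.isMaximal (by simpa using hq.ne_zero)
    let := Ideal.Quotient.field (Ideal.span {(q : 𝓞 F)})
    have hfinF : Finite (𝓞 F ⧸ Ideal.span {(q : 𝓞 F)}) :=
      Nat.finite_of_card_ne_zero (by rw [hcardF]; exact pow_ne_zero _ hq.ne_zero)
    let ψ := Ideal.Quotient.lift (Ideal.span {(q : 𝓞 F)}) φ (by
      intro a ha
      obtain ⟨c, rfl⟩ := Ideal.mem_span_singleton.1 ha
      rw [map_mul, hφq, zero_mul])
    have hψ : Function.Bijective ψ :=
      (Nat.bijective_iff_injective_and_card ψ).2 ⟨ψ.injective, hcardF.trans hcardL.symm⟩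
    intro y
    obtain ⟨x, rfl⟩ := hψ.2 y
    obtain ⟨x, rfl⟩ := Ideal.Quotient.mk_surjective x
    exact ⟨x, rfl⟩
  intro lam
  -- the norm of a unit is congruent to its `n`-th power
  have hnorm : φ (Algebra.norm (𝓞 F) (lam : 𝓞 L)) = Ideal.Quotient.mk 𝔮 (lam : 𝓞 L) ^ n := by
    obtain ⟨b, hb⟩ := hφ (Ideal.Quotient.mk 𝔮 ((lam⁻¹ : (𝓞 L)ˣ) : 𝓞 L))
    have hb1 : Ideal.Quotient.mk 𝔮 (lam : 𝓞 L) * φ b = 1 := by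
      rw [hb, ← map_mul, Units.mul_inv, map_one]
    obtain ⟨y, hy⟩ := exists_pow_prime_pow_eq_one_add_mul hq hramL.ge
      (x := (lam : 𝓞 L) * algebraMap (𝓞 F) (𝓞 L) b)
      (by rw [← Ideal.Quotient.mk_eq_mk_iff_sub_mem, map_mul, map_one]; exact hb1)
    have hdvd := Algebra.dvd_norm_one_add_smul_sub_one (q : 𝓞 F) y
    rw [Algebra.smul_def, map_natCast, ← hy, map_pow] at hdvd
    have hpow : φ (Algebra.norm (𝓞 F) ((lam : 𝓞 L) * algebraMap (𝓞 F) (𝓞 L) b)) ^ q ^ n = 1 := by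
      obtain ⟨c, hc⟩ := hdvd
      rw [← sub_eq_zero, ← map_pow, ← map_one φ, ← map_sub, hc, map_mul, hφq, zero_mul]
    have hone : φ (Algebra.norm (𝓞 F) ((lam : 𝓞 L) * algebraMap (𝓞 F) (𝓞 L) b)) = 1 := by
      rw [← FiniteField.pow_card_pow n (φ _), hcard, ← pow_mul, two_mul, pow_add,
        pow_mul, hpow, one_pow]
    rw [map_mul, Algebra.norm_algebraMap, hrank, map_mul, map_pow] at hone
    have hb2 := congrArg (· ^ n) hb1
    simp only [mul_pow, one_pow] at hb2
    exact mul_right_cancel₀ (right_ne_zero_of_mul_eq_one hone) (hone.trans hb2.symm)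
  have hsix : Ideal.Quotient.mk 𝔮 (lam : 𝓞 L) ^ 6 = 1 := by
    have h1 : Ideal.Quotient.mk 𝔮 (lam : 𝓞 L) ^ (6 * n) = 1 := by
      have h := congrArg Units.val
        (hωF.unit_pow_six_eq_one (Units.map (Algebra.norm (𝓞 F) : 𝓞 L →* 𝓞 F) lam))
      rw [Units.val_pow_eq_pow_val, Units.coe_map, Units.val_one] at h
      rw [mul_comm, pow_mul, ← hnorm, ← map_pow]
      exact (congrArg φ h).trans (map_one φ)
    have h2 : Ideal.Quotient.mk 𝔮 (lam : 𝓞 L) ^ (q ^ 2 - 1) = 1 := by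
      rw [← hcard]
      exact FiniteField.pow_card_sub_one_eq_one _ (lam.isUnit.map _).ne_zero
    have h3 : orderOf (Ideal.Quotient.mk 𝔮 (lam : 𝓞 L)) ∣ Nat.gcd (6 * n) (q ^ 2 - 1) :=
      Nat.dvd_gcd (orderOf_dvd_of_pow_eq_one h1) (orderOf_dvd_of_pow_eq_one h2)
    rw [Nat.Coprime.gcd_mul_right_cancel 6 hgcd] at h3
    exact orderOf_dvd_iff_pow_eq_one.1 (h3.trans (Nat.gcd_dvd_left _ _))
  have hw : Ideal.Quotient.mk 𝔮 ωI ^ 2 + Ideal.Quotient.mk 𝔮 ωI + 1 = 0 := by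
    simpa using congrArg (Ideal.Quotient.mk 𝔮) hwI
  simp only [Set.mem_insert_iff, Set.mem_singleton_iff, exists_eq_or_imp, exists_eq_left,
    ← Ideal.Quotient.mk_eq_mk_iff_sub_mem, map_neg, map_add, map_one]
  exact eq_of_pow_six_eq_one hw hsix
end
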